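/- arXiv:1407.2977 — 2 statements merged into one kernel-verified Lean document; each statement's English description precedes it below -/
import Mathlib

section
/- Let X be a real Banach space admitting a C¹ Lipschitz bump function and let H : X × ℝ → ℝ be a continuous Hamiltonian satisfying condition (A). Suppose there are constants K₀ ≤ K₁ with K₀ ≤ H(x,0) ≤ K₁ for all x ∈ X, and suppose that for every x ∈ X there exist r > 0 and R > 0 such that H(z,t) > K₁ whenever ‖z − x‖ < r and t > R. Then there exists a unique bounded continuous function u : X → ℝ which is a viscosity solution of u(x) + H(x, ‖du(x)‖) = 0; moreover this u is locally Lipschitz, satisfies −K₁ ≤ u ≤ −K₀, and equals the pointwise supremum of the family 𝓕 = {w : X → ℝ : w is a viscosity subsolution of the equation and −K₁ ≤ w ≤ −K₀ on X}. -/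
open Filter Topology

variable {X : Type*} [NormedAddCommGroup X] [NormedSpace ℝ X]

/-- `X` admits a `C¹` Lipschitz bump function. -/
def HasC1LipBump (X : Type*) [NormedAddCommGroup X] [NormedSpace ℝ X] : Prop :=
  ∃ b : X → ℝ, ContDiff ℝ 1 b ∧ (∃ K : NNReal, LipschitzWith K b) ∧
    Bornology.IsBounded (Function.support b) ∧ (Function.support b).Nonempty

/-- The Fréchet subdifferential of a real-valued function `f` at `x`. -/
def subdiff (f : X → ℝ) (x : X) : Set (X →L[ℝ] ℝ) :=
  {Δ | ∀ ε > (0:ℝ), ∃ δ > (0:ℝ), ∀ h : X, ‖h‖ < δ →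
    f x + Δ h - ε * ‖h‖ ≤ f (x + h)}

/-- The Fréchet superdifferential of a real-valued function `f` at `x`. -/
def superdiff (f : X → ℝ) (x : X) : Set (X →L[ℝ] ℝ) :=
  {Δ | ∀ ε > (0:ℝ), ∃ δ > (0:ℝ), ∀ h : X, ‖h‖ < δ →
    f (x + h) ≤ f x + Δ h + ε * ‖h‖}

/-- Condition (A) for a Hamiltonian `H : X × ℝ → ℝ`. -/
def CondA (H : X → ℝ → ℝ) : Prop :=
  ∃ (C : ℝ) (ω : ℝ → ℝ → ℝ), 0 ≤ C ∧
    Continuous (fun p : ℝ × ℝ => ω p.1 p.2) ∧ ω 0 0 = 0 ∧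
    ∀ (x₁ x₂ : X) (t₁ t₂ : ℝ),
      |H x₁ t₁ - H x₂ t₂| ≤ ω ‖x₁ - x₂‖ (t₁ - t₂) + C * max |t₁| |t₂| * ‖x₁ - x₂‖

/-- `u` is a viscosity subsolution of `u(x) + H(x, ‖du(x)‖) = 0`. -/
def IsViscositySub (H : X → ℝ → ℝ) (u : X → ℝ) : Prop :=
  UpperSemicontinuous u ∧ ∀ x : X, ∀ Δ ∈ superdiff u x, u x + H x ‖Δ‖ ≤ 0

/-- `v` is a viscosity supersolution of `v(x) + H(x, ‖dv(x)‖) = 0`. -/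
def IsViscositySuper (H : X → ℝ → ℝ) (v : X → ℝ) : Prop :=
  LowerSemicontinuous v ∧ ∀ x : X, ∀ Δ ∈ subdiff v x, 0 ≤ v x + H x ‖Δ‖

/-- A smooth variational principle: a lower semicontinuous function bounded below attains its
minimum after adding a suitable series of translated gauges. -/
theorem exists_isMin_add_tsum_gauge {E : Type*} [PseudoMetricSpace E] [CompleteSpace E] [Nonempty E]
    {ρ : E → E → ℝ} {B : ℝ} (hcont : ∀ a, Continuous fun z => ρ z a) (hzero : ∀ a, ρ a a = 0)
    (hB : ∀ z a, ρ z a ≤ B) (hlow : ∀ z a, min (dist z a ^ 2) 1 ≤ 4 * ρ z a)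
    {f : E → ℝ} (hf : LowerSemicontinuous f) {m : ℝ} (hm : ∀ z, m ≤ f z) {ε : ℝ} (hε : 0 < ε) :
    ∃ (a : ℕ → E) (y : E), ∀ z, f y + ∑' i, ε * (1 / 2) ^ i * ρ y (a i) ≤
      f z + ∑' i, ε * (1 / 2) ^ i * ρ z (a i) := by
  have hnn : ∀ z a, 0 ≤ ρ z a := fun z a => by
    have h1 := hlow z a
    have h2 : 0 ≤ min (dist z a ^ 2) 1 := by positivity
    linarith
  have hpick : ∀ (n : ℕ) (g : E → ℝ), ∃ a, BddBelow (Set.range g) →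
      ∀ z, g a ≤ g z + ε / 32 * (1 / 8) ^ n := by
    intro n g
    by_cases hg : BddBelow (Set.range g)
    · have hpos : 0 < ε / 32 * (1 / 8 : ℝ) ^ n := by positivity
      obtain ⟨_, ⟨a, rfl⟩, ha⟩ := exists_lt_of_csInf_lt (Set.range_nonempty g)
        (lt_add_of_pos_right (sInf (Set.range g)) hpos)
      refine ⟨a, fun _ z => ?_⟩
      have := csInf_le hg (Set.mem_range_self z)
      linarith
    · exact ⟨Classical.arbitrary E, fun h => absurd h hg⟩
  choose pick hpick using hpick
  let G : ℕ → E → ℝ := fun n =>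
    Nat.rec f (fun n g z => g z + ε * (1 / 2) ^ n * ρ z (pick n g)) n
  let a : ℕ → E := fun n => pick n (G n)
  have hG : ∀ n z, G (n + 1) z = G n z + ε * (1 / 2) ^ n * ρ z (a n) := fun n z => rfl
  have hGsum : ∀ n z, G n z = f z + ∑ i ∈ Finset.range n, ε * (1 / 2) ^ i * ρ z (a i) := by
    intro n z
    induction n with
    | zero => simp [G]
    | succ n ih => rw [hG, ih, Finset.sum_range_succ]; ring
  have hterm : ∀ z i, 0 ≤ ε * (1 / 2) ^ i * ρ z (a i) := fun z i =>
    mul_nonneg (by positivity) (hnn _ _)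
  have hterm' : ∀ z i, ε * (1 / 2) ^ i * ρ z (a i) ≤ ε * B * (1 / 2) ^ i := fun z i => by
    have : ε * (1 / 2) ^ i * ρ z (a i) ≤ ε * (1 / 2) ^ i * B :=
      mul_le_mul_of_nonneg_left (hB _ _) (by positivity)
    linarith
  have hgeo : Summable fun i : ℕ => ε * B * (1 / 2 : ℝ) ^ i := summable_geometric_two.mul_left _
  have hsum : ∀ z, Summable fun i => ε * (1 / 2) ^ i * ρ z (a i) := fun z =>
    Summable.of_nonneg_of_le (hterm z) (hterm' z) hgeo
  have hbdd : ∀ n, BddBelow (Set.range (G n)) := by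
    rintro n
    refine ⟨m, ?_⟩
    rintro _ ⟨z, rfl⟩
    rw [hGsum]
    have := Finset.sum_nonneg fun i (_ : i ∈ Finset.range n) => hterm z i
    linarith [hm z]
  have ha : ∀ n z, G n (a n) ≤ G n z + ε / 32 * (1 / 8) ^ n := fun n => hpick n (G n) (hbdd n)
  have hdist : ∀ n, dist (a n) (a (n + 1)) ≤ 1 / 2 / 2 ^ n := by
    intro n
    have h1 := ha (n + 1) (a n)
    have h2 := ha n (a (n + 1))
    rw [hG, hG, hzero] at h1
    have h3 := hlow (a (n + 1)) (a n)
    have hp : (0 : ℝ) < (1 / 2) ^ n := by positivity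
    have h8 : (1 / 8 : ℝ) ^ n = (1 / 2) ^ n * ((1 / 2) ^ n * (1 / 2) ^ n) := by
      rw [← mul_pow, ← mul_pow]; norm_num
    rw [pow_succ] at h1
    set q : ℝ := (1 / 2) ^ n with hq
    rw [h8] at h1 h2
    have h4 : ε * q * ρ (a (n + 1)) (a n) ≤ ε * q * (1 / 16 * (q * q)) := by
      have : 0 < ε * q * (q * q) := by positivity
      linarith
    have h5 := le_of_mul_le_mul_left h4 (by positivity)
    have hq1 : q ≤ 1 := pow_le_one₀ (by norm_num) (by norm_num)
    have h6 : dist (a (n + 1)) (a n) ^ 2 ≤ (1 / 2 * q) ^ 2 := by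
      rcases min_le_iff.1 (h3.trans (show _ ≤ (1 / 2 * q) ^ 2 by nlinarith)) with h | h
      · exact h
      · nlinarith
    have h7 := abs_le_of_sq_le_sq h6 (by positivity)
    rw [dist_comm]
    have h9 : 1 / 2 / 2 ^ n = 1 / 2 * q := by rw [hq, one_div_pow]; ring
    rw [h9]
    exact (le_abs_self _).trans (by simpa using h7)
  obtain ⟨y, hy⟩ := cauchySeq_tendsto_of_complete (cauchySeq_of_le_geometric_two hdist)
  refine ⟨a, y, fun z => ?_⟩
  by_contra! hlt
  have hcts : Continuous fun z => ∑' i, ε * (1 / 2) ^ i * ρ z (a i) :=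
    continuous_tsum (fun i => continuous_const.mul (hcont _)) hgeo fun i z => by
      rw [Real.norm_eq_abs, abs_of_nonneg (hterm z i)]
      exact hterm' z i
  have hlsc := hf.add hcts.lowerSemicontinuous
  obtain ⟨c, hc1, hc2⟩ := exists_between hlt
  have hev := hy.eventually (hlsc y c hc2)
  have hle : ∀ n, f (a n) + ∑' i, ε * (1 / 2) ^ i * ρ (a n) (a i) ≤
      f z + ∑' i, ε * (1 / 2) ^ i * ρ z (a i) +
        (ε / 32 * (1 / 8) ^ n + ε * B * 2 * (1 / 2) ^ n) := by
    intro n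
    have h1 := ha n z
    rw [hGsum, hGsum] at h1
    have h2 := (hsum z).sum_le_tsum (Finset.range n) fun i _ => hterm z i
    have h3 := (hsum (a n)).sum_add_tsum_nat_add n
    have h4 : ∑' i, ε * (1 / 2) ^ (i + n) * ρ (a n) (a (i + n)) ≤
        ∑' i, ε * B * (1 / 2 : ℝ) ^ (i + n) :=
      Summable.tsum_le_tsum (fun i => hterm' _ _) ((summable_nat_add_iff n).2 (hsum (a n)))
        ((summable_nat_add_iff n).2 hgeo)
    have h5 : ∑' i, ε * B * (1 / 2 : ℝ) ^ (i + n) = ε * B * 2 * (1 / 2) ^ n := by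
      simp_rw [pow_add]
      rw [tsum_mul_left, tsum_mul_right, tsum_geometric_two]
      ring
    linarith
  have hlim : Tendsto (fun n : ℕ => f z + ∑' i, ε * (1 / 2) ^ i * ρ z (a i) +
        (ε / 32 * (1 / 8) ^ n + ε * B * 2 * (1 / 2) ^ n)) atTop
      (𝓝 (f z + ∑' i, ε * (1 / 2) ^ i * ρ z (a i) + (ε / 32 * 0 + ε * B * 2 * 0))) :=
    ((((tendsto_pow_atTop_nhds_zero_of_lt_one (by norm_num) (by norm_num)).const_mul _).add
      ((tendsto_pow_atTop_nhds_zero_of_lt_one (by norm_num) (by norm_num)).const_mul _)).const_add _)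
  have := ge_of_tendsto hlim (hev.mono fun n hn => hn.le.trans (hle n))
  linarith

theorem mem_superdiff_of_touching {u g : X → ℝ} {g' : X →L[ℝ] ℝ} {x : X}
    (hg : HasFDerivAt g g' x) (hmax : ∀ z, u z - g z ≤ u x - g x) : g' ∈ superdiff u x := by
  intro ε hε
  obtain ⟨δ, hδ, h⟩ := Metric.eventually_nhds_iff.1
    ((hasFDerivAt_iff_isLittleO_nhds_zero.1 hg).bound hε)
  refine ⟨δ, hδ, fun k hk => ?_⟩
  have h1 := h (y := k) (by simpa using hk)
  have h2 := hmax (x + k)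
  have h3 := (abs_le.1 h1).2
  linarith

theorem mem_subdiff_of_touching {v g : X → ℝ} {g' : X →L[ℝ] ℝ} {x : X}
    (hg : HasFDerivAt g g' x) (hmin : ∀ z, v x - g x ≤ v z - g z) : g' ∈ subdiff v x := by
  intro ε hε
  obtain ⟨δ, hδ, h⟩ := Metric.eventually_nhds_iff.1
    ((hasFDerivAt_iff_isLittleO_nhds_zero.1 hg).bound hε)
  refine ⟨δ, hδ, fun k hk => ?_⟩
  have h1 := h (y := k) (by simpa using hk)
  have h2 := hmin (x + k)
  have h3 := (abs_le.1 h1).1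
  linarith

theorem norm_le_of_forall_small_le {T : X →L[ℝ] ℝ} {L : ℝ} (hL : 0 ≤ L)
    (h : ∀ ε > (0 : ℝ), ∃ δ > (0 : ℝ), ∀ k : X, ‖k‖ < δ → T k ≤ (L + ε) * ‖k‖) : ‖T‖ ≤ L := by
  refine le_of_forall_pos_le_add fun ε hε => ?_
  obtain ⟨δ, hδ, h⟩ := h ε hε
  refine ContinuousLinearMap.opNorm_le_of_ball hδ (by positivity) fun k hk => ?_
  have hk' : ‖k‖ < δ := by simpa using hk
  have h1 := h (-k) (by simpa using hk')
  rw [map_neg, norm_neg] at h1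
  exact abs_le.2 ⟨by linarith, h k hk'⟩

theorem norm_sub_le_of_mem_subdiff {v : X → ℝ} {x : X} {Δ Δ₀ : X →L[ℝ] ℝ} {L δ₀ : ℝ} (hL : 0 ≤ L)
    (hΔ : Δ ∈ subdiff v x) (hδ₀ : 0 < δ₀)
    (hv : ∀ k : X, ‖k‖ < δ₀ → v (x + k) ≤ v x + Δ₀ k + L * ‖k‖) : ‖Δ - Δ₀‖ ≤ L := by
  refine norm_le_of_forall_small_le hL fun ε hε => ?_
  obtain ⟨δ, hδ, h⟩ := hΔ ε hε
  refine ⟨min δ δ₀, lt_min hδ hδ₀, fun k hk => ?_⟩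
  have h1 := h k (hk.trans_le (min_le_left _ _))
  have h2 := hv k (hk.trans_le (min_le_right _ _))
  rw [_root_.sub_apply]
  linarith

theorem norm_sub_le_of_mem_superdiff {v : X → ℝ} {x : X} {Δ Δ₀ : X →L[ℝ] ℝ} {L δ₀ : ℝ} (hL : 0 ≤ L)
    (hΔ : Δ ∈ superdiff v x) (hδ₀ : 0 < δ₀)
    (hv : ∀ k : X, ‖k‖ < δ₀ → v x + Δ₀ k - L * ‖k‖ ≤ v (x + k)) : ‖Δ - Δ₀‖ ≤ L := by
  rw [norm_sub_rev]
  refine norm_le_of_forall_small_le hL fun ε hε => ?_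
  obtain ⟨δ, hδ, h⟩ := hΔ ε hε
  refine ⟨min δ δ₀, lt_min hδ hδ₀, fun k hk => ?_⟩
  have h1 := h k (hk.trans_le (min_le_left _ _))
  have h2 := hv k (hk.trans_le (min_le_right _ _))
  rw [_root_.sub_apply]
  linarith

theorem le_norm_of_mem_subdiff_cone {L : ℝ} {y z : X} (hzy : z ≠ y) {Δ : X →L[ℝ] ℝ}
    (hΔ : Δ ∈ subdiff (fun x => L * ‖x - y‖) z) : L ≤ ‖Δ‖ := by
  refine le_of_forall_pos_le_add fun ε hε => ?_
  obtain ⟨δ, hδ, h⟩ := hΔ ε hε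
  have hd : 0 < ‖z - y‖ := norm_pos_iff.2 (sub_ne_zero.2 hzy)
  obtain ⟨s, hs0, hs⟩ : ∃ s : ℝ, 0 < s ∧ s ≤ 1 ∧ s * ‖z - y‖ < δ := by
    refine ⟨min 1 (δ / (2 * ‖z - y‖)), by positivity, min_le_left _ _, ?_⟩
    calc _ ≤ δ / (2 * ‖z - y‖) * ‖z - y‖ := by gcongr; exact min_le_right _ _
      _ = δ / 2 := by field_simp
      _ < δ := by linarith
  have hn : ‖(-s) • (z - y)‖ = s * ‖z - y‖ := by
    rw [norm_smul, norm_neg, Real.norm_eq_abs, abs_of_pos hs0]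
  have h1 := h ((-s) • (z - y)) (by rw [hn]; exact hs.2)
  have h2 : z + (-s) • (z - y) - y = (1 - s) • (z - y) := by module
  beta_reduce at h1
  rw [h2, hn, norm_smul, Real.norm_eq_abs, abs_of_nonneg (by linarith [hs.1]), map_smul,
    smul_eq_mul] at h1
  have h3 : Δ (z - y) ≤ ‖Δ‖ * ‖z - y‖ := (le_abs_self _).trans (Δ.le_opNorm _)
  have h4 : s * (‖z - y‖ * L) ≤ s * (‖z - y‖ * (‖Δ‖ + ε)) := by nlinarith
  exact le_of_mul_le_mul_left (le_of_mul_le_mul_left h4 hs0) hd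

/-- A bounded function, differentiable with bounded derivative, comparable with the squared norm
near the origin. -/
structure IsGauge (φ : X → ℝ) (φ' : X → X →L[ℝ] ℝ) (K : ℝ) : Prop where
  pos : 0 < K
  hasFDerivAt : ∀ x, HasFDerivAt φ (φ' x) x
  map_zero : φ 0 = 0
  le_two : ∀ x, φ x ≤ 2
  norm_deriv_le : ∀ x, ‖φ' x‖ ≤ K
  norm_deriv_le_mul : ∀ x, ‖φ' x‖ ≤ K * ‖x‖
  min_le : ∀ x, min (‖x‖ ^ 2) 1 ≤ 4 * φ x

theorem exists_abs_deriv_smoothTransition_le :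
    ∃ M : ℝ, 0 ≤ M ∧ ∀ t, |deriv Real.smoothTransition t| ≤ M := by
  have hc : Continuous (deriv Real.smoothTransition) :=
    (Real.smoothTransition.contDiff (n := 1)).continuous_deriv (by norm_num)
  obtain ⟨M, hM⟩ := isCompact_Icc.exists_bound_of_continuousOn (s := Set.Icc (0 : ℝ) 1)
    hc.continuousOn
  refine ⟨M, (norm_nonneg _).trans (hM 0 (by simp)), fun t => ?_⟩
  have hM0 : 0 ≤ M := (norm_nonneg _).trans (hM 0 (by simp))
  by_cases h0 : t < 0
  · have : Real.smoothTransition =ᶠ[𝓝 t] fun _ => 0 :=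
      (eventually_lt_nhds h0).mono fun s hs => Real.smoothTransition.zero_of_nonpos hs.le
    rw [this.deriv_eq]
    simpa using hM0
  by_cases h1 : 1 < t
  · have : Real.smoothTransition =ᶠ[𝓝 t] fun _ => 1 :=
      (eventually_gt_nhds h1).mono fun s hs => Real.smoothTransition.one_of_one_le hs.le
    rw [this.deriv_eq]
    simpa using hM0
  · exact hM t ⟨not_lt.1 h0, not_lt.1 h1⟩

theorem HasC1LipBump.exists_cutoff (hbump : HasC1LipBump X) :
    ∃ (θ : X → ℝ) (a K : ℝ), 0 < a ∧ 0 < K ∧ Differentiable ℝ θ ∧ (∀ x, ‖fderiv ℝ θ x‖ ≤ K) ∧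
      (∀ x, 0 ≤ θ x) ∧ (∀ x, θ x ≤ 1) ∧ (∀ x, ‖x‖ < a → θ x = 0) ∧ ∀ x, 1 ≤ ‖x‖ → θ x = 1 := by
  obtain ⟨b, hb, ⟨K, hK⟩, hbd, x₀, hx₀⟩ := hbump
  rw [Function.mem_support] at hx₀
  obtain ⟨A, hA, hbA⟩ : ∃ A > 0, ∀ z, A ≤ ‖z‖ → b (x₀ + z) = 0 := by
    obtain ⟨A, hA0, hA⟩ := hbd.exists_pos_norm_lt
    refine ⟨A + ‖x₀‖, by positivity, fun z hz => ?_⟩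
    by_contra h
    have h1 := hA _ h
    have h2 : ‖z‖ ≤ ‖x₀ + z‖ + ‖x₀‖ := by
      simpa using norm_sub_le (x₀ + z) x₀
    linarith
  obtain ⟨M, hM0, hM⟩ := exists_abs_deriv_smoothTransition_le
  let g : X → ℝ := fun z => 1 - 2 * ((b x₀)⁻¹ * b (x₀ + A • z))
  have hbdiff : Differentiable ℝ b := hb.differentiable (by norm_num)
  have hg' : ∀ z, HasFDerivAt g (-((2 * (b x₀)⁻¹ * A) • fderiv ℝ b (x₀ + A • z))) z := by
    intro z
    have h1 : HasFDerivAt (fun z => x₀ + A • z) (A • ContinuousLinearMap.id ℝ X) z :=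
      ((hasFDerivAt_id z).const_smul A).const_add x₀
    have h2 := (((hbdiff (x₀ + A • z)).hasFDerivAt.comp z h1).const_mul ((b x₀)⁻¹)).const_mul 2
    refine (h2.const_sub 1).congr_fderiv ?_
    ext k
    simp
    ring
  have hgcont : Continuous g := continuous_iff_continuousAt.2 fun z => (hg' z).continuousAt
  have hst : ∀ t, HasDerivAt Real.smoothTransition (deriv Real.smoothTransition t) t := fun t =>
    ((Real.smoothTransition.contDiff (n := 1)).differentiable (by norm_num) t).hasDerivAt
  have hθ' : ∀ z, HasFDerivAt (fun z => Real.smoothTransition (g z)) _ z := fun z =>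
    (hst (g z)).comp_hasFDerivAt z (hg' z)
  have hg0 : g 0 < 0 := by simp [g, inv_mul_cancel₀ hx₀]
  obtain ⟨a, ha, hag⟩ := Metric.eventually_nhds_iff.1 (hgcont.continuousAt.eventually_lt_const hg0)
  refine ⟨fun z => Real.smoothTransition (g z), a, M * (|2 * (b x₀)⁻¹ * A| * K) + 1, ha,
    by positivity, fun z => (hθ' z).differentiableAt, fun z => ?_,
    fun z => Real.smoothTransition.nonneg _, fun z => Real.smoothTransition.le_one _,
    fun z hz => Real.smoothTransition.zero_of_nonpos (hag (by simpa using hz)).le, fun z hz => ?_⟩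
  · rw [(hθ' z).fderiv, norm_smul, norm_neg, norm_smul, Real.norm_eq_abs, Real.norm_eq_abs]
    have h1 := norm_fderiv_le_of_lipschitz ℝ hK (x₀ := x₀ + A • z)
    calc _ ≤ M * (|2 * (b x₀)⁻¹ * A| * K) := by
            gcongr
            exact hM _
      _ ≤ _ := by linarith
  · have : b (x₀ + A • z) = 0 := hbA _ (by
      rw [norm_smul, Real.norm_eq_abs, abs_of_pos hA]
      nlinarith)
    simp [g, this]

theorem HasC1LipBump.exists_isGauge (hbump : HasC1LipBump X) :
    ∃ (φ : X → ℝ) (φ' : X → X →L[ℝ] ℝ) (K : ℝ), IsGauge φ φ' K := by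
  obtain ⟨θ, a, K, ha, hK, hθd, hθK, hθ0, hθ1, hθa, hθA⟩ := hbump.exists_cutoff
  let φ : X → ℝ := fun x => ∑' n : ℕ, (1 / 4 : ℝ) ^ n * θ ((2 : ℝ) ^ n • x)
  have hgeo4 : Summable fun n : ℕ => (1 / 4 : ℝ) ^ n :=
    summable_geometric_of_lt_one (by norm_num) (by norm_num)
  have hnn : ∀ x n, 0 ≤ (1 / 4 : ℝ) ^ n * θ ((2 : ℝ) ^ n • x) := fun x n =>
    mul_nonneg (by positivity) (hθ0 _)
  have hle : ∀ x n, (1 / 4 : ℝ) ^ n * θ ((2 : ℝ) ^ n • x) ≤ (1 / 4) ^ n := fun x n =>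
    mul_le_of_le_one_right (by positivity) (hθ1 _)
  have hsum : ∀ x, Summable fun n : ℕ => (1 / 4 : ℝ) ^ n * θ ((2 : ℝ) ^ n • x) := fun x =>
    Summable.of_nonneg_of_le (hnn x) (hle x) hgeo4
  have hself : ∀ x, φ x = θ x + 1 / 4 * φ ((2 : ℝ) • x) := by
    intro x
    change ∑' n : ℕ, _ = _
    rw [(hsum x).tsum_eq_zero_add]
    simp only [φ, ← tsum_mul_left, pow_zero, one_mul, one_smul]
    congr 1
    refine tsum_congr fun n => ?_
    rw [smul_smul, ← pow_succ, pow_succ (1 / 4 : ℝ)]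
    ring
  let d : ℕ → X → X →L[ℝ] ℝ := fun n x => ((1 / 2 : ℝ) ^ n) • fderiv ℝ θ ((2 : ℝ) ^ n • x)
  have hd : ∀ n x, HasFDerivAt (fun x => (1 / 4 : ℝ) ^ n * θ ((2 : ℝ) ^ n • x)) (d n x) x := by
    intro n x
    have h1 : HasFDerivAt (fun z : X => (2 : ℝ) ^ n • z)
        ((2 : ℝ) ^ n • ContinuousLinearMap.id ℝ X) x := (hasFDerivAt_id x).const_smul _
    have h2 := (((hθd ((2 : ℝ) ^ n • x)).hasFDerivAt).comp x h1).const_mul ((1 / 4 : ℝ) ^ n)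
    refine h2.congr_fderiv ?_
    ext k
    have : (1 / 2 : ℝ) ^ n = (1 / 4) ^ n * 2 ^ n := by rw [← mul_pow]; norm_num
    simp only [d, _root_.smul_apply, ContinuousLinearMap.comp_apply, map_smul,
      ContinuousLinearMap.id_apply, smul_eq_mul, this]
    ring
  have hdK : ∀ n x, ‖d n x‖ ≤ K * (1 / 2 : ℝ) ^ n := by
    intro n x
    rw [norm_smul, norm_pow, mul_comm]
    have : ‖(1 / 2 : ℝ)‖ = 1 / 2 := by norm_num
    rw [this]
    gcongr
    exact hθK _
  have hφ' : ∀ x, HasFDerivAt φ (∑' n, d n x) x := fun x =>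
    hasFDerivAt_tsum (summable_geometric_two.mul_left K) hd hdK (hsum 0) x
  have hφK : ∀ x, ‖∑' n, d n x‖ ≤ 2 * K := fun x => by
    rw [mul_comm]
    exact tsum_of_norm_bounded (hasSum_geometric_two.mul_left K) fun n => hdK n x
  have hφnn : ∀ x, 0 ≤ φ x := fun x => tsum_nonneg (hnn x)
  have hself' : ∀ x, ‖x‖ < a →
      ∑' n, d n x = (1 / 2 : ℝ) • ∑' n, d n ((2 : ℝ) • x) := by
    intro x hx
    have hev : φ =ᶠ[𝓝 x] fun z => 1 / 4 * φ ((2 : ℝ) • z) := by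
      filter_upwards [continuous_norm.continuousAt.eventually_lt_const hx] with z hz
      rw [hself z, hθa z hz, zero_add]
    have h1 : HasFDerivAt (fun z : X => (2 : ℝ) • z)
        ((2 : ℝ) • ContinuousLinearMap.id ℝ X) x := (hasFDerivAt_id x).const_smul _
    have h2 := (((hφ' ((2 : ℝ) • x)).comp x h1).const_mul (1 / 4)).congr_of_eventuallyEq hev
    rw [(hφ' x).unique h2]
    ext k
    simp only [_root_.smul_apply, ContinuousLinearMap.comp_apply, map_smul,
      ContinuousLinearMap.id_apply, smul_eq_mul]
    ring
  have hpow : ∀ {s x : ℝ}, 0 < s → 0 < x → ∃ n : ℕ, s ≤ 2 ^ n * x := by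
    intro s x hs hx
    obtain ⟨n, hn⟩ := pow_unbounded_of_one_lt (s / x) (one_lt_two)
    exact ⟨n, ((div_lt_iff₀ hx).1 hn).le⟩
  have hderiv : ∀ (n : ℕ) (x : X), a ≤ 2 ^ n * ‖x‖ → ‖∑' n, d n x‖ ≤ 2 * K / a * ‖x‖ := by
    intro n
    have hbig : ∀ x : X, a ≤ ‖x‖ → ‖∑' n, d n x‖ ≤ 2 * K / a * ‖x‖ := fun x hx => by
      refine (hφK x).trans ?_
      rw [div_mul_eq_mul_div, le_div_iff₀ ha]
      gcongr
    induction n with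
    | zero => intro x hx; exact hbig x (by simpa using hx)
    | succ n ih =>
      intro x hx
      by_cases hxa : a ≤ ‖x‖
      · exact hbig x hxa
      have h2 : ‖(2 : ℝ) • x‖ = 2 * ‖x‖ := by rw [norm_smul]; norm_num
      have h1 := ih ((2 : ℝ) • x) (by rw [h2]; rw [pow_succ] at hx; linarith)
      rw [hself' x (not_le.1 hxa), norm_smul]
      rw [h2] at h1
      have : ‖(1 / 2 : ℝ)‖ = 1 / 2 := by norm_num
      rw [this]
      linarith
  have hbig : ∀ x : X, 1 ≤ ‖x‖ → 1 ≤ φ x := fun x hx => by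
    rw [hself, hθA x hx]
    linarith [hφnn ((2 : ℝ) • x)]
  have hlow : ∀ (n : ℕ) (x : X), 1 ≤ 2 ^ n * ‖x‖ → min (‖x‖ ^ 2) 1 ≤ 4 * φ x := by
    intro n
    induction n with
    | zero =>
      intro x hx
      have := hbig x (by simpa using hx)
      exact (min_le_right _ _).trans (by linarith)
    | succ n ih =>
      intro x hx
      by_cases hx1 : 1 ≤ ‖x‖
      · exact (min_le_right _ _).trans (by linarith [hbig x hx1])
      have h2 : ‖(2 : ℝ) • x‖ = 2 * ‖x‖ := by rw [norm_smul]; norm_num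
      have h3 : 1 / 4 * φ ((2 : ℝ) • x) ≤ φ x := by rw [hself x]; linarith [hθ0 x]
      refine (min_le_left _ _).trans ?_
      by_cases hx2 : 1 ≤ ‖(2 : ℝ) • x‖
      · have := hbig _ hx2
        nlinarith [norm_nonneg x]
      · have h4 := ih ((2 : ℝ) • x) (by rw [h2]; rw [pow_succ] at hx; linarith)
        rw [min_eq_left (by nlinarith [norm_nonneg ((2 : ℝ) • x)]), h2] at h4
        nlinarith
  have hzero : φ 0 = 0 := by
    simp [φ, hθa 0 (by simpa using ha)]
  refine ⟨φ, fun x => ∑' n, d n x, 2 * K + 2 * K / a, by positivity, hφ', hzero, fun x => ?_,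
    fun x => (hφK x).trans (by simp only [le_add_iff_nonneg_right]; positivity), fun x => ?_,
    fun x => ?_⟩
  · have h1 : φ x ≤ ∑' n : ℕ, (1 / 4 : ℝ) ^ n := (hsum x).tsum_le_tsum (hle x) hgeo4
    rw [tsum_geometric_of_lt_one (by norm_num) (by norm_num)] at h1
    norm_num at h1
    linarith
  · rcases eq_or_ne x 0 with rfl | hx
    · have h1 := congrArg norm (hself' 0 (by simpa using ha))
      have : ‖(1 / 2 : ℝ)‖ = 1 / 2 := by norm_num
      rw [norm_smul, smul_zero, this] at h1
      rw [norm_zero, mul_zero]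
      linarith
    · obtain ⟨n, hn⟩ := hpow ha (norm_pos_iff.2 hx)
      refine (hderiv n x hn).trans ?_
      gcongr
      simp only [le_add_iff_nonneg_left]
      positivity
  · rcases eq_or_ne x 0 with rfl | hx
    · simp [hzero]
    · obtain ⟨n, hn⟩ := hpow one_pos (norm_pos_iff.2 hx)
      exact hlow n x hn

section GaugeSeries

variable {φ : X → ℝ} {φ' : X → X →L[ℝ] ℝ} {K : ℝ}

theorem IsGauge.nonneg (hφ : IsGauge φ φ' K) (x : X) : 0 ≤ φ x := by
  have h1 := hφ.min_le x
  have h2 : 0 ≤ min (‖x‖ ^ 2) 1 := by positivity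
  linarith

theorem IsGauge.summable_series (hφ : IsGauge φ φ' K) {ε : ℝ} (hε : 0 < ε) (a : ℕ → X) (x : X) :
    Summable fun i : ℕ => ε * (1 / 2) ^ i * φ (x - a i) := by
  refine Summable.of_nonneg_of_le (fun i => mul_nonneg (by positivity) (hφ.nonneg _)) (fun i => ?_)
    (summable_geometric_two.mul_left (ε * 2))
  calc _ ≤ ε * (1 / 2) ^ i * 2 := by gcongr; exact hφ.le_two _
    _ = _ := by ring

theorem IsGauge.series_nonneg (hφ : IsGauge φ φ' K) {ε : ℝ} (hε : 0 < ε) (a : ℕ → X) (x : X) :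
    0 ≤ ∑' i : ℕ, ε * (1 / 2) ^ i * φ (x - a i) :=
  tsum_nonneg fun i => mul_nonneg (by positivity) (hφ.nonneg _)

theorem IsGauge.series_le (hφ : IsGauge φ φ' K) {ε : ℝ} (hε : 0 < ε) (a : ℕ → X) (x : X) :
    ∑' i : ℕ, ε * (1 / 2) ^ i * φ (x - a i) ≤ 4 * ε := by
  have h := (hφ.summable_series hε a x).tsum_le_tsum (g := fun i : ℕ => ε * 2 * (1 / 2 : ℝ) ^ i)
    (fun i => ?_) (summable_geometric_two.mul_left (ε * 2))
  · rw [tsum_mul_left, tsum_geometric_two] at h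
    linarith
  · calc _ ≤ ε * (1 / 2) ^ i * 2 := by gcongr; exact hφ.le_two _
      _ = _ := by ring

theorem IsGauge.exists_hasFDerivAt_series (hφ : IsGauge φ φ' K) {ε : ℝ} (hε : 0 < ε) (a : ℕ → X)
    (x : X) : ∃ p' : X →L[ℝ] ℝ, ‖p'‖ ≤ 2 * K * ε ∧
      HasFDerivAt (fun z => ∑' i : ℕ, ε * (1 / 2) ^ i * φ (z - a i)) p' x := by
  have hd : ∀ (i : ℕ) z, HasFDerivAt (fun z => ε * (1 / 2) ^ i * φ (z - a i))
      ((ε * (1 / 2) ^ i) • φ' (z - a i)) z := fun i z =>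
    ((hφ.hasFDerivAt (z - a i)).comp z ((hasFDerivAt_id z).sub_const (a i))).const_mul _
  have hb : ∀ (i : ℕ) z, ‖(ε * (1 / 2) ^ i) • φ' (z - a i)‖ ≤ K * ε * (1 / 2) ^ i := fun i z => by
    rw [norm_smul, Real.norm_eq_abs, abs_of_pos (by positivity)]
    calc _ ≤ ε * (1 / 2) ^ i * K := by gcongr; exact hφ.norm_deriv_le _
      _ = _ := by ring
  refine ⟨_, ?_, hasFDerivAt_tsum (summable_geometric_two.mul_left (K * ε)) hd hb
    (hφ.summable_series hε a 0) x⟩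
  have h := tsum_of_norm_bounded (hasSum_geometric_two.mul_left (K * ε)) fun i => hb i x
  linarith

/-- Doubling of variables: the difference of an upper and a lower semicontinuous function is almost
maximized near the diagonal, at points with nearly equal super- and subgradients. -/
theorem IsGauge.exists_close_superdiff_subdiff [CompleteSpace X] (hφ : IsGauge φ φ' K)
    {u v : X → ℝ} (hu : UpperSemicontinuous u) (hv : LowerSemicontinuous v) {M m : ℝ}
    (hM : ∀ x, u x ≤ M) (hm : ∀ x, m ≤ v x) {η : ℝ} (hη : 0 < η) :
    ∃ x y, ∃ Δ₁ ∈ superdiff u x, ∃ Δ₂ ∈ subdiff v y, ‖x - y‖ < η ∧ ‖Δ₁ - Δ₂‖ < η ∧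
      ‖Δ₁‖ * ‖x - y‖ < η ∧ ‖Δ₂‖ * ‖x - y‖ < η ∧ ∀ z, u z - v z - η < u x - v y := by
  have hK := hφ.pos
  obtain ⟨τ, hτ, hτ1, hτ2, hτ3, hτ4⟩ : ∃ τ > 0, τ ≤ 1 / 32 ∧ τ ≤ η ^ 2 / 32 ∧ K * τ ≤ η / 40 ∧
      τ ≤ η / 2 := by
    refine ⟨min (min (1 / 32) (η ^ 2 / 32)) (min (η / 40 / K) (η / 2)), by positivity,
      (min_le_left _ _).trans (min_le_left _ _), (min_le_left _ _).trans (min_le_right _ _), ?_,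
      (min_le_right _ _).trans (min_le_right _ _)⟩
    rw [← le_div_iff₀' hK]
    exact (min_le_right _ _).trans (min_le_left _ _)
  let Φ : ℕ → X × X → ℝ := fun n z => u z.1 - v z.2 - 2 ^ n * φ (z.1 - z.2)
  have hΦle : ∀ n z, Φ n z ≤ M - m := fun n z => by
    have : 0 ≤ 2 ^ n * φ (z.1 - z.2) := mul_nonneg (by positivity) (hφ.nonneg _)
    change u z.1 - v z.2 - 2 ^ n * φ (z.1 - z.2) ≤ _
    linarith [hM z.1, hm z.2]
  have hbdd : ∀ n, BddAbove (Set.range (Φ n)) := fun n =>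
    ⟨M - m, by rintro _ ⟨z, rfl⟩; exact hΦle n z⟩
  have hdiag : ∀ n z, u z - v z ≤ ⨆ z, Φ n z := fun n z => by
    refine le_trans (le_of_eq ?_) (le_ciSup (hbdd n) (z, z))
    simp [Φ, hφ.map_zero]
  obtain ⟨n, hn⟩ : ∃ n, (⨆ z, Φ n z) < (⨆ z, Φ (n + 1) z) + τ := by
    by_contra! h
    have h1 : ∀ n : ℕ, (⨆ z, Φ n z) + n * τ ≤ ⨆ z, Φ 0 z := by
      intro n
      induction n with
      | zero => simp
      | succ n ih =>
        have := h n
        push_cast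
        linarith
    obtain ⟨n, hn⟩ := exists_nat_gt (((⨆ z, Φ 0 z) - (u 0 - v 0)) / τ)
    rw [div_lt_iff₀ hτ] at hn
    linarith [h1 n, hdiag n 0]
  set N : ℝ := 2 ^ (n + 1) with hN
  have hN1 : 1 ≤ N := one_le_pow₀ (by norm_num)
  have hφc : Continuous φ := continuous_iff_continuousAt.2 fun x => (hφ.hasFDerivAt x).continuousAt
  have hlsc : LowerSemicontinuous fun z : X × X => v z.2 + -u z.1 + N * φ (z.1 - z.2) := by
    refine LowerSemicontinuous.add (LowerSemicontinuous.add ?_ ?_)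
      (Continuous.lowerSemicontinuous (by fun_prop))
    · exact hv.comp continuous_snd
    · exact hu.neg.comp continuous_fst
  obtain ⟨a, ⟨x, y⟩, hmin⟩ := exists_isMin_add_tsum_gauge (E := X × X)
    (ρ := fun z a => φ (z.1 - a.1) + φ (z.2 - a.2)) (B := 4) (fun a => by fun_prop)
    (fun a => by simp [hφ.map_zero])
    (fun z a => by linarith [hφ.le_two (z.1 - a.1), hφ.le_two (z.2 - a.2)])
    (fun z a => by
      rw [Prod.dist_eq, dist_eq_norm, dist_eq_norm]
      rcases max_cases ‖z.1 - a.1‖ ‖z.2 - a.2‖ with h | h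
      · rw [h.1]; linarith [hφ.min_le (z.1 - a.1), hφ.nonneg (z.2 - a.2)]
      · rw [h.1]; linarith [hφ.min_le (z.2 - a.2), hφ.nonneg (z.1 - a.1)])
    hlsc (m := m - M) (fun z => by
      have := hΦle (n + 1) z
      change u z.1 - v z.2 - N * φ (z.1 - z.2) ≤ _ at this
      linarith) (ε := τ / 8) (by positivity)
  have hε : 0 < τ / 8 := by positivity
  set p : X → ℝ := fun x => ∑' i, τ / 8 * (1 / 2) ^ i * φ (x - (a i).1) with hp
  set q : X → ℝ := fun y => ∑' i, τ / 8 * (1 / 2) ^ i * φ (y - (a i).2) with hq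
  have hmin : ∀ x' y', v y - u x + N * φ (x - y) + (p x + q y) ≤
      v y' - u x' + N * φ (x' - y') + (p x' + q y') := fun x' y' => by
    have h := hmin (x', y')
    simp only [mul_add] at h
    rw [(hφ.summable_series hε _ x).tsum_add (hφ.summable_series hε _ y),
      (hφ.summable_series hε _ x').tsum_add (hφ.summable_series hε _ y')] at h
    change v y + -u x + N * φ (x - y) + (p x + q y) ≤
      v y' + -u x' + N * φ (x' - y') + (p x' + q y') at h
    linarith
  have hp0 : 0 ≤ p x := hφ.series_nonneg hε _ x
  have hq0 : 0 ≤ q y := hφ.series_nonneg hε _ y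
  have hsup : (⨆ z, Φ (n + 1) z) ≤ Φ (n + 1) (x, y) + τ := by
    refine ciSup_le fun z => ?_
    have h1 := hmin z.1 z.2
    have h2 : p z.1 ≤ 4 * (τ / 8) := hφ.series_le hε _ _
    have h3 : q z.2 ≤ 4 * (τ / 8) := hφ.series_le hε _ _
    change u z.1 - v z.2 - N * φ (z.1 - z.2) ≤ u x - v y - N * φ (x - y) + τ
    linarith
  have hΦn : Φ n (x, y) = Φ (n + 1) (x, y) + 2 ^ n * φ (x - y) := by
    simp only [Φ, pow_succ]; ring
  have hpen : N * φ (x - y) < 4 * τ := by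
    have h1 := le_ciSup (hbdd n) (x, y)
    rw [hN, pow_succ]
    linarith
  have hφ0 := hφ.nonneg (x - y)
  have hφsmall : φ (x - y) < 4 * τ := lt_of_le_of_lt (by nlinarith) hpen
  have hsq : ‖x - y‖ ^ 2 ≤ 4 * φ (x - y) := by
    rcases min_le_iff.1 (hφ.min_le (x - y)) with h | h
    · exact h
    · linarith
  have hxy1 : ‖x - y‖ < 1 := by
    by_contra! h
    nlinarith
  have hxyη : ‖x - y‖ < η := by
    by_contra! h
    nlinarith
  have hΔ : ‖N • φ' (x - y)‖ * ‖x - y‖ ≤ 16 * (K * τ) := by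
    rw [norm_smul, Real.norm_eq_abs, abs_of_pos (by linarith)]
    have h1 : ‖φ' (x - y)‖ * ‖x - y‖ ≤ K * (4 * φ (x - y)) :=
      calc _ ≤ K * ‖x - y‖ * ‖x - y‖ := by gcongr; exact hφ.norm_deriv_le_mul _
        _ = K * ‖x - y‖ ^ 2 := by ring
        _ ≤ _ := by gcongr
    calc N * ‖φ' (x - y)‖ * ‖x - y‖ = N * (‖φ' (x - y)‖ * ‖x - y‖) := by ring
      _ ≤ N * (K * (4 * φ (x - y))) := by gcongr
      _ = 4 * K * (N * φ (x - y)) := by ring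
      _ ≤ 4 * K * (4 * τ) := by gcongr
      _ = _ := by ring
  obtain ⟨p', hp'n, hp'⟩ := hφ.exists_hasFDerivAt_series hε (fun i => (a i).1) x
  obtain ⟨q', hq'n, hq'⟩ := hφ.exists_hasFDerivAt_series hε (fun i => (a i).2) y
  have hg : HasFDerivAt (fun z => N * φ (z - y) + p z) (N • φ' (x - y) + p') x :=
    (((hφ.hasFDerivAt (x - y)).comp x ((hasFDerivAt_id x).sub_const y)).const_mul N).add hp'
  have hg2 : HasFDerivAt (fun z => -(N * φ (x - z) + q z)) (N • φ' (x - y) - q') y := by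
    refine ((((hφ.hasFDerivAt (x - y)).comp y
      ((hasFDerivAt_id y).const_sub x)).const_mul N).add hq').neg.congr_fderiv ?_
    ext k
    simp
    ring
  have hmul : ∀ s : X →L[ℝ] ℝ, ‖s‖ ≤ 2 * K * (τ / 8) → ‖s‖ * ‖x - y‖ ≤ K * τ := fun s hs => by
    have h1 : ‖s‖ * ‖x - y‖ ≤ ‖s‖ * 1 := by gcongr
    have : 0 < K * τ := by positivity
    linarith
  have hfin : ∀ s : X →L[ℝ] ℝ, ‖s‖ ≤ 2 * K * (τ / 8) →
      ‖N • φ' (x - y) + s‖ * ‖x - y‖ < η := fun s hs =>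
    calc _ ≤ (‖N • φ' (x - y)‖ + ‖s‖) * ‖x - y‖ := by gcongr; exact norm_add_le _ _
      _ = ‖N • φ' (x - y)‖ * ‖x - y‖ + ‖s‖ * ‖x - y‖ := by ring
      _ ≤ 16 * (K * τ) + K * τ := add_le_add hΔ (hmul s hs)
      _ < η := by linarith
  refine ⟨x, y, _, mem_superdiff_of_touching hg fun z => ?_, _,
    mem_subdiff_of_touching hg2 fun z => ?_, hxyη, ?_, hfin p' hp'n, ?_, fun z => ?_⟩
  · have := hmin z y
    linarith
  · have := hmin x z
    linarith
  · have h1 : N • φ' (x - y) + p' - (N • φ' (x - y) - q') = p' + q' := by abel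
    rw [h1]
    have h2 := norm_add_le p' q'
    linarith
  · rw [sub_eq_add_neg]
    exact hfin (-q') (by rwa [norm_neg])
  · have h1 := (hdiag (n + 1) z).trans hsup
    have h2 : Φ (n + 1) (x, y) = u x - v y - N * φ (x - y) := rfl
    have h3 : 0 ≤ N * φ (x - y) := by positivity
    linarith

end GaugeSeries

theorem mem_superdiff_of_eventually_le {u w : X → ℝ} {x : X} {Δ : X →L[ℝ] ℝ}
    (hΔ : Δ ∈ superdiff w x) (hle : ∀ᶠ z in 𝓝 x, u z ≤ w z) (heq : u x = w x) :
    Δ ∈ superdiff u x := by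
  intro ε hε
  obtain ⟨δ, hδ, h⟩ := hΔ ε hε
  obtain ⟨δ', hδ', h'⟩ := Metric.eventually_nhds_iff.1 hle
  refine ⟨min δ δ', lt_min hδ hδ', fun k hk => ?_⟩
  have h1 := h k (hk.trans_le (min_le_left _ _))
  have h2 := h' (y := x + k) (by simpa using hk.trans_le (min_le_right _ _))
  linarith

theorem isViscositySub_const {H : X → ℝ → ℝ} {c : ℝ} (h : ∀ x, c + H x 0 ≤ 0) :
    IsViscositySub H fun _ => c := by
  refine ⟨continuous_const.upperSemicontinuous, fun x Δ hΔ => ?_⟩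
  have h1 := norm_sub_le_of_mem_superdiff (Δ₀ := 0) le_rfl hΔ one_pos fun k _ => by simp
  rw [sub_zero] at h1
  rw [h1.antisymm (norm_nonneg _)]
  exact h x

theorem isViscositySuper_const {H : X → ℝ → ℝ} {c : ℝ} (h : ∀ x, 0 ≤ c + H x 0) :
    IsViscositySuper H fun _ => c := by
  refine ⟨continuous_const.lowerSemicontinuous, fun x Δ hΔ => ?_⟩
  have h1 := norm_sub_le_of_mem_subdiff (Δ₀ := 0) le_rfl hΔ one_pos fun k _ => by simp
  rw [sub_zero] at h1
  rw [h1.antisymm (norm_nonneg _)]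
  exact h x

section Viscosity

variable {φ : X → ℝ} {φ' : X → X →L[ℝ] ℝ} {K : ℝ}

/-- Comparison principle. -/
theorem IsViscositySub.le_of_isViscositySuper [CompleteSpace X] (hφ : IsGauge φ φ' K)
    {H : X → ℝ → ℝ} (hHA : CondA H) {u v : X → ℝ} (hu : IsViscositySub H u)
    (hv : IsViscositySuper H v) {M m : ℝ} (hM : ∀ x, u x ≤ M) (hm : ∀ x, m ≤ v x) (z : X) :
    u z ≤ v z := by
  obtain ⟨C, ω, hC, hω, hω0, hA⟩ := hHA
  refine le_of_forall_pos_le_add fun ε hε => ?_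
  obtain ⟨δ, hδ, hωδ⟩ := Metric.eventually_nhds_iff.1
    ((hω.tendsto (0, 0)).eventually_lt_const (show ω 0 0 < ε / 2 by rw [hω0]; positivity))
  have hη : 0 < min δ (ε / 2 / (C + 1)) := by positivity
  obtain ⟨x, y, Δ₁, hΔ₁, Δ₂, hΔ₂, h1, h2, h3, h4, h5⟩ :=
    hφ.exists_close_superdiff_subdiff hu.1 hv.1 hM hm hη
  set η := min δ (ε / 2 / (C + 1)) with hηdef
  have hηC : (C + 1) * η ≤ ε / 2 := by
    rw [← le_div_iff₀' (by positivity)]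
    exact min_le_right _ _
  have hηδ : η ≤ δ := min_le_left _ _
  have h6 := hu.2 x Δ₁ hΔ₁
  have h7 := hv.2 y Δ₂ hΔ₂
  have h8 := (abs_le.1 (hA x y ‖Δ₁‖ ‖Δ₂‖)).1
  have h9 : |‖Δ₁‖ - ‖Δ₂‖| < δ := ((abs_norm_sub_norm_le _ _).trans_lt h2).trans_le hηδ
  have h10 : ω ‖x - y‖ (‖Δ₁‖ - ‖Δ₂‖) < ε / 2 := by
    refine hωδ (y := (‖x - y‖, ‖Δ₁‖ - ‖Δ₂‖)) ?_
    rw [Prod.dist_eq, Real.dist_eq, Real.dist_eq, sub_zero, sub_zero, abs_norm]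
    exact max_lt (h1.trans_le hηδ) h9
  have h11 : C * max |‖Δ₁‖| |‖Δ₂‖| * ‖x - y‖ ≤ C * η := by
    rw [mul_assoc, abs_norm, abs_norm]
    gcongr
    rcases max_cases ‖Δ₁‖ ‖Δ₂‖ with h | h <;> rw [h.1]
    exacts [h3.le, h4.le]
  linarith [h5 z]

/-- An upper semicontinuous bounded function with bounded superdifferentials on a ball is Lipschitz
near the center, with a constant independent of the function. -/
theorem le_add_mul_norm_of_norm_superdiff_le [CompleteSpace X] (hφ : IsGauge φ φ' K) {w : X → ℝ}
    (hw : UpperSemicontinuous w) {m M R L r : ℝ} (hm : ∀ x, m ≤ w x) (hM : ∀ x, w x ≤ M)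
    {x₀ : X} (hr : 0 < r) (hL : 0 ≤ L) (hRL : R < L) (hosc : M - m + 1 ≤ L * (r / 4))
    (hR : ∀ z, ‖z - x₀‖ < r → ∀ Δ ∈ superdiff w z, ‖Δ‖ ≤ R) {y : X} (hy : ‖y - x₀‖ < r / 2)
    (x : X) : w x ≤ w y + L * ‖x - y‖ := by
  by_contra! hlt
  set g := w x - (w y + L * ‖x - y‖) with hg
  have hg0 : 0 < g := by linarith
  obtain ⟨δ, hδ, hδw⟩ := Metric.eventually_nhds_iff.1 (hw y (w y + g / 2) (by linarith))
  have hη : 0 < min (min (g / 2) δ) (min (r / 4) (L - R)) := by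
    have : 0 < L - R := by linarith
    positivity
  obtain ⟨p, q, Δ₁, hΔ₁, Δ₂, hΔ₂, h1, h2, -, -, h5⟩ :=
    hφ.exists_close_superdiff_subdiff hw
      (v := fun z => L * ‖z - y‖) (Continuous.lowerSemicontinuous (by fun_prop)) hM
      (m := 0) (fun z => by positivity) hη
  simp only [lt_min_iff] at h1 h2
  have h6 := h5 x
  have h7 : min (min (g / 2) δ) (min (r / 4) (L - R)) ≤ g / 2 :=
    (min_le_left _ _).trans (min_le_left _ _)
  have h8 : w y + g / 2 < w p - L * ‖q - y‖ := by linarith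
  rcases eq_or_ne q y with rfl | hqy
  · have := hδw (y := p) (by rw [dist_eq_norm]; exact h1.1.2)
    rw [sub_self, norm_zero, mul_zero] at h8
    linarith
  · have h9 := le_norm_of_mem_subdiff_cone hqy hΔ₂
    have h10 : ‖Δ₂‖ - ‖Δ₁‖ ≤ ‖Δ₁ - Δ₂‖ := by rw [norm_sub_rev]; exact norm_sub_norm_le _ _
    have h11 : r ≤ ‖p - x₀‖ := by
      by_contra! h
      linarith [hR p h Δ₁ hΔ₁]
    have h12 : ‖p - x₀‖ ≤ ‖p - q‖ + ‖q - y‖ + ‖y - x₀‖ := by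
      have : p - x₀ = (p - q) + (q - y) + (y - x₀) := by abel
      rw [this]
      exact norm_add₃_le
    have h13 : r / 4 ≤ ‖q - y‖ := by linarith
    have h14 : L * (r / 4) ≤ L * ‖q - y‖ := by gcongr
    linarith [hm y, hM p]

/-- An upper semicontinuous pointwise supremum of subsolutions is a subsolution. -/
theorem isViscositySub_of_forall_exists_lt [CompleteSpace X] (hφ : IsGauge φ φ' K)
    {H : X → ℝ → ℝ} (hH : Continuous fun p : X × ℝ => H p.1 p.2) {F : Set (X → ℝ)} {u : X → ℝ}
    {M : ℝ} (hu : UpperSemicontinuous u) (hM : ∀ x, u x ≤ M)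
    (hF : ∀ w ∈ F, IsViscositySub H w) (hle : ∀ w ∈ F, ∀ x, w x ≤ u x)
    (hex : ∀ x, ∀ ε > 0, ∃ w ∈ F, u x - ε < w x) : IsViscositySub H u := by
  refine ⟨hu, fun x₀ Δ hΔ => ?_⟩
  by_contra! hpos
  obtain ⟨ρ, hρ, hρH⟩ : ∃ ρ > 0, ∀ z t, ‖z - x₀‖ < ρ → |t - ‖Δ‖| < ρ → 0 < u x₀ - ρ + H z t := by
    set γ := u x₀ + H x₀ ‖Δ‖ with hγ
    obtain ⟨ρ, hρ, h⟩ := Metric.eventually_nhds_iff.1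
      ((hH.tendsto (x₀, ‖Δ‖)).eventually_const_lt
        (show H x₀ ‖Δ‖ - γ / 2 < H x₀ ‖Δ‖ by linarith))
    refine ⟨min ρ (γ / 2), by positivity, fun z t hz ht => ?_⟩
    have h1 := h (y := (z, t)) (by
      rw [Prod.dist_eq, Real.dist_eq, dist_eq_norm]
      exact max_lt (hz.trans_le (min_le_left _ _)) (ht.trans_le (min_le_left _ _)))
    have h2 : min ρ (γ / 2) ≤ γ / 2 := min_le_right _ _
    change H x₀ ‖Δ‖ - γ / 2 < H z t at h1
    linarith
  obtain ⟨ε, hε, hερ⟩ : ∃ ε > 0, ε = ρ / 8 := ⟨_, by positivity, rfl⟩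
  obtain ⟨δ, hδ, hδu⟩ := hΔ ε hε
  obtain ⟨N, hN⟩ : ∃ N, N = 3 * ‖Δ‖ + 4 * (M - u x₀ + 1) / δ := ⟨_, rfl⟩
  have hMu : 0 ≤ M - u x₀ := by linarith [hM x₀]
  have hΔ0 := norm_nonneg Δ
  have hND : 3 * ‖Δ‖ ≤ N := by
    rw [hN, le_add_iff_nonneg_right]; positivity
  have hNδ : N * δ = 3 * ‖Δ‖ * δ + 4 * (M - u x₀ + 1) := by
    rw [hN]; field_simp
  have hΔb : ∀ k, -(‖Δ‖ * ‖k‖) ≤ Δ k ∧ Δ k ≤ ‖Δ‖ * ‖k‖ := fun k => abs_le.1 (Δ.le_opNorm k)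
  let v : X → ℝ := fun z =>
    u x₀ + Δ (z - x₀) + 2 * ε * ‖z - x₀‖ + N * max 0 (‖z - x₀‖ - δ / 2)
  have hN0 : 0 ≤ N := by linarith
  have hv0 : v x₀ = u x₀ := by
    have : max 0 (0 - δ / 2) = 0 := max_eq_left (by linarith)
    simp only [v, sub_self, map_zero, norm_zero, this]
    ring
  have hv1 : ∀ z, u x₀ + Δ (z - x₀) + 2 * ε * ‖z - x₀‖ ≤ v z := fun z => by
    have : 0 ≤ N * max 0 (‖z - x₀‖ - δ / 2) := by positivity
    simp only [v]
    linarith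
  have hv2 : ∀ z, u x₀ + (N - ‖Δ‖) * ‖z - x₀‖ - N * δ / 2 ≤ v z := fun z => by
    have h1 : N * (‖z - x₀‖ - δ / 2) ≤ N * max 0 (‖z - x₀‖ - δ / 2) := by
      gcongr; exact le_max_right _ _
    have h2 : 0 ≤ 2 * ε * ‖z - x₀‖ := by positivity
    simp only [v]
    linarith [(hΔb (z - x₀)).1]
  obtain ⟨κ, hκ, hκδ, hκρ, hκΔ⟩ : ∃ κ > 0, κ ≤ δ / 2 ∧ κ ≤ ρ / 2 ∧ ‖Δ‖ * κ ≤ ρ / 4 := by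
    refine ⟨min (δ / 2) (min (ρ / 2) (ρ / 4 / (‖Δ‖ + 1))), by positivity, min_le_left _ _,
      (min_le_right _ _).trans (min_le_left _ _), ?_⟩
    calc _ ≤ (‖Δ‖ + 1) * (ρ / 4 / (‖Δ‖ + 1)) := by
          gcongr
          · linarith
          · exact (min_le_right _ _).trans (min_le_right _ _)
      _ = ρ / 4 := by field_simp
  obtain ⟨η, hη, hη1, hηδ, hηρ, hηκ⟩ : ∃ η > 0, η ≤ 1 / 2 ∧ η ≤ δ / 4 ∧ η ≤ ρ / 8 ∧
      (‖Δ‖ + ε + 2) * η ≤ ε * κ := by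
    refine ⟨min (min (1 / 2) (δ / 4)) (min (ρ / 8) (ε * κ / (‖Δ‖ + ε + 2))), by positivity,
      (min_le_left _ _).trans (min_le_left _ _), (min_le_left _ _).trans (min_le_right _ _),
      (min_le_right _ _).trans (min_le_left _ _), ?_⟩
    rw [← le_div_iff₀' (by positivity)]
    exact (min_le_right _ _).trans (min_le_right _ _)
  obtain ⟨w, hwF, hw⟩ := hex x₀ η hη
  obtain ⟨x, y, Δ₁, hΔ₁, Δ₂, hΔ₂, h1, h2, -, -, h5⟩ :=
    hφ.exists_close_superdiff_subdiff (hF w hwF).1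
      (v := v) (Continuous.lowerSemicontinuous (by fun_prop)) (fun z => (hle w hwF z).trans (hM z))
      (m := u x₀ - N * δ / 2) (fun z => by
        have h1 : 0 ≤ (N - ‖Δ‖) * ‖z - x₀‖ := mul_nonneg (by linarith) (norm_nonneg _)
        linarith [hv2 z]) hη
  have h6 := h5 x₀
  rw [hv0] at h6
  have hwx : v y - 2 * η < w x := by linarith
  have hyδ : ‖y - x₀‖ < 3 * δ / 4 := by
    by_contra! h
    have h7 : (N - ‖Δ‖) * (3 * δ / 4) ≤ (N - ‖Δ‖) * ‖y - x₀‖ :=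
      mul_le_mul_of_nonneg_left h (by linarith)
    have h8 := hv2 y
    have h9 := (hle w hwF x).trans (hM x)
    nlinarith
  have hxy : ‖x - x₀‖ ≤ ‖x - y‖ + ‖y - x₀‖ := norm_sub_le_norm_sub_add_norm_sub _ _ _
  have hyκ : ‖y - x₀‖ < κ := by
    have h7 := hδu (x - x₀) (by linarith)
    rw [add_sub_cancel] at h7
    have h8 := hv1 y
    have h9 := hle w hwF x
    have h10 : Δ (x - x₀) = Δ (x - y) + Δ (y - x₀) := by rw [← map_add]; congr 1; abel
    have h11 := (hΔb (x - y)).2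
    have h12 : (‖Δ‖ + ε) * ‖x - y‖ ≤ (‖Δ‖ + ε) * η := by gcongr
    have h13 : ε * ‖x - x₀‖ ≤ ε * (‖x - y‖ + ‖y - x₀‖) := by gcongr
    have h14 : ε * ‖y - x₀‖ < ε * κ := by linarith
    exact lt_of_mul_lt_mul_left h14 hε.le
  have hΔ₂Δ : ‖Δ₂ - Δ‖ ≤ 2 * ε := by
    refine norm_sub_le_of_mem_subdiff (by positivity) hΔ₂
      (show 0 < δ / 2 - ‖y - x₀‖ by linarith) fun k hk => ?_
    have h7 : ‖y + k - x₀‖ ≤ ‖y - x₀‖ + ‖k‖ := by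
      rw [add_sub_right_comm]; exact norm_add_le _ _
    have h8 : max 0 (‖y + k - x₀‖ - δ / 2) = 0 := max_eq_left (by linarith)
    have h9 : Δ (y + k - x₀) = Δ (y - x₀) + Δ k := by rw [← map_add]; congr 1; abel
    have h10 := hv1 y
    have h11 : 2 * ε * ‖y + k - x₀‖ ≤ 2 * ε * (‖y - x₀‖ + ‖k‖) := by gcongr
    have h12 : v (y + k) = u x₀ + Δ (y + k - x₀) + 2 * ε * ‖y + k - x₀‖ := by
      simp only [v, h8, mul_zero, add_zero]
    linarith
  have hΔ₁Δ : ‖Δ₁ - Δ‖ < ρ := by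
    have := norm_sub_le_norm_sub_add_norm_sub Δ₁ Δ₂ Δ
    linarith
  have h7 := hρH x ‖Δ₁‖ (by linarith) ((abs_norm_sub_norm_le _ _).trans_lt hΔ₁Δ)
  have h8 := (hF w hwF).2 x Δ₁ hΔ₁
  have h9 : ‖Δ‖ * ‖y - x₀‖ ≤ ‖Δ‖ * κ := by gcongr
  have h10 := (hΔb (y - x₀)).1
  have h11 : 0 ≤ 2 * ε * ‖y - x₀‖ := by positivity
  linarith [hv1 y]

/-- A continuous subsolution failing to be a supersolution can be increased near some point while
remaining a subsolution. -/
theorem exists_isViscositySub_lt {H : X → ℝ → ℝ} (hH : Continuous fun p : X × ℝ => H p.1 p.2)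
    {u : X → ℝ} {M : ℝ} (huc : Continuous u) (hM : ∀ x, u x ≤ M) (hu : IsViscositySub H u)
    {x₀ : X} {Δ : X →L[ℝ] ℝ} (hΔ : Δ ∈ subdiff u x₀) (hneg : u x₀ + H x₀ ‖Δ‖ < 0) :
    ∃ w : X → ℝ, IsViscositySub H w ∧ (∀ x, u x ≤ w x) ∧ u x₀ < w x₀ ∧ ∃ M', ∀ x, w x ≤ M' := by
  obtain ⟨ρ, hρ, hρH⟩ : ∃ ρ > 0, ∀ z t, ‖z - x₀‖ < ρ → |t - ‖Δ‖| < ρ → u x₀ + ρ + H z t < 0 := by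
    set γ := -(u x₀ + H x₀ ‖Δ‖) with hγ
    have hγ0 : 0 < γ := by linarith
    obtain ⟨ρ, hρ, h⟩ := Metric.eventually_nhds_iff.1
      ((hH.tendsto (x₀, ‖Δ‖)).eventually_lt_const
        (show H x₀ ‖Δ‖ < H x₀ ‖Δ‖ + γ / 2 by linarith))
    refine ⟨min ρ (γ / 2), by positivity, fun z t hz ht => ?_⟩
    have h1 := h (y := (z, t)) (by
      rw [Prod.dist_eq, Real.dist_eq, dist_eq_norm]
      exact max_lt (hz.trans_le (min_le_left _ _)) (ht.trans_le (min_le_left _ _)))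
    have h2 : min ρ (γ / 2) ≤ γ / 2 := min_le_right _ _
    change H z t < H x₀ ‖Δ‖ + γ / 2 at h1
    linarith
  obtain ⟨ε, hε, hερ⟩ : ∃ ε > 0, ε = ρ / 4 := ⟨_, by positivity, rfl⟩
  obtain ⟨δ, hδ, hδu⟩ := hΔ ε hε
  obtain ⟨d, hd, hdδ, hdρ, hdΔ⟩ : ∃ d > 0, d ≤ δ ∧ d ≤ ρ ∧ ‖Δ‖ * d ≤ ρ / 4 := by
    refine ⟨min δ (min ρ (ρ / 4 / (‖Δ‖ + 1))), by positivity, min_le_left _ _,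
      (min_le_right _ _).trans (min_le_left _ _), ?_⟩
    calc _ ≤ (‖Δ‖ + 1) * (ρ / 4 / (‖Δ‖ + 1)) := by
          gcongr
          · linarith
          · exact (min_le_right _ _).trans (min_le_right _ _)
      _ = ρ / 4 := by field_simp
  obtain ⟨κ, hκ, hκρ, hκd⟩ : ∃ κ > 0, κ ≤ ρ / 4 ∧ κ ≤ ε * d / 4 :=
    ⟨min (ρ / 4) (ε * d / 4), by positivity, min_le_left _ _, min_le_right _ _⟩
  let ψ : X → ℝ := fun z => u x₀ + κ + Δ (z - x₀) - 2 * ε * ‖z - x₀‖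
  have hψc : Continuous ψ := by fun_prop
  have hψu : ∀ z, ‖z - x₀‖ < d → ψ z ≤ u z + κ - ε * ‖z - x₀‖ := fun z hz => by
    have h1 := hδu (z - x₀) (hz.trans_le hdδ)
    rw [add_sub_cancel] at h1
    simp only [ψ]
    linarith
  have hψle : ∀ z, ‖z - x₀‖ < d → ψ z ≤ u x₀ + ρ / 2 := fun z hz => by
    have h1 : Δ (z - x₀) ≤ ‖Δ‖ * ‖z - x₀‖ := (le_abs_self _).trans (Δ.le_opNorm _)
    have h2 : ‖Δ‖ * ‖z - x₀‖ ≤ ‖Δ‖ * d := by gcongr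
    have h3 : 0 ≤ 2 * ε * ‖z - x₀‖ := by positivity
    simp only [ψ]
    linarith
  classical
  let w : X → ℝ := fun z => if ‖z - x₀‖ < d then max (u z) (ψ z) else u z
  have hwin : ∀ z, ‖z - x₀‖ < d → w z = max (u z) (ψ z) := fun z hz => if_pos hz
  have hwout : ∀ z, d / 2 < ‖z - x₀‖ → w z = u z := fun z hz => by
    by_cases h : ‖z - x₀‖ < d
    · rw [hwin z h, max_eq_left]
      have h1 : ε * (d / 2) ≤ ε * ‖z - x₀‖ := by gcongr
      have h2 : 0 < ε * d := by positivity
      linarith [hψu z h]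
    · exact if_neg h
  have huw : ∀ z, u z ≤ w z := fun z => by
    by_cases h : ‖z - x₀‖ < d
    · rw [hwin z h]; exact le_max_left _ _
    · exact (if_neg h).ge
  have hnc : Continuous fun z : X => ‖z - x₀‖ := by fun_prop
  have hball : ∀ z, ‖z - x₀‖ < d → ∀ᶠ y in 𝓝 z, ‖y - x₀‖ < d := fun z hz =>
    hnc.continuousAt.eventually_lt_const hz
  have hwc : Continuous w := by
    refine continuous_iff_continuousAt.2 fun z => ?_
    by_cases h : ‖z - x₀‖ < d
    · exact (huc.max hψc).continuousAt.congr ((hball z h).mono fun y hy => (hwin y hy).symm)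
    · have h' : d / 2 < ‖z - x₀‖ := by linarith
      exact huc.continuousAt.congr
        ((hnc.continuousAt.eventually_const_lt h').mono fun y hy => (hwout y hy).symm)
  refine ⟨w, ⟨hwc.upperSemicontinuous, fun z Δ' hΔ' => ?_⟩, huw, ?_, max M (u x₀ + ρ / 2),
    fun z => ?_⟩
  · by_cases heq : u z = w z
    · rw [← heq]
      exact hu.2 z Δ' (mem_superdiff_of_eventually_le hΔ' (Eventually.of_forall huw) heq)
    have hz : ‖z - x₀‖ < d := by
      by_contra h
      exact heq (if_neg h).symm
    have hwψ : ψ z = w z := by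
      rw [hwin z hz] at heq ⊢
      rcases max_choice (u z) (ψ z) with h | h
      · exact absurd h.symm heq
      · exact h.symm
    have hmem : Δ' ∈ superdiff ψ z := mem_superdiff_of_eventually_le hΔ'
      ((hball z hz).mono fun y hy => (le_max_right _ _).trans (hwin y hy).ge) hwψ
    have h1 : ‖Δ' - Δ‖ ≤ 2 * ε := by
      refine norm_sub_le_of_mem_superdiff (by positivity) hmem one_pos fun k _ => ?_
      have h7 : ‖z + k - x₀‖ ≤ ‖z - x₀‖ + ‖k‖ := by
        rw [add_sub_right_comm]; exact norm_add_le _ _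
      have h9 : Δ (z + k - x₀) = Δ (z - x₀) + Δ k := by rw [← map_add]; congr 1; abel
      have h11 : 2 * ε * ‖z + k - x₀‖ ≤ 2 * ε * (‖z - x₀‖ + ‖k‖) := by gcongr
      simp only [ψ, h9]
      linarith
    have h2 := hρH z ‖Δ'‖ (hz.trans_le hdρ) ((abs_norm_sub_norm_le _ _).trans_lt (by linarith))
    rw [← hwψ]
    linarith [hψle z hz]
  · rw [hwin x₀ (by simpa using hd)]
    refine lt_max_of_lt_right ?_
    simp only [ψ, sub_self, map_zero, norm_zero]
    linarith
  · by_cases h : ‖z - x₀‖ < d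
    · rw [hwin z h]
      exact max_le_max (hM z) (hψle z h)
    · rw [show w z = u z from if_neg h]
      exact (hM z).trans (le_max_left _ _)

end Viscosity

theorem stmt16 [CompleteSpace X] (hbump : HasC1LipBump X)
    (H : X → ℝ → ℝ) (hHcont : Continuous (fun p : X × ℝ => H p.1 p.2))
    (hHA : CondA H)
    (K₀ K₁ : ℝ) (hK : K₀ ≤ K₁) (hH0 : ∀ x : X, K₀ ≤ H x 0 ∧ H x 0 ≤ K₁)
    (hcoer : ∀ x : X, ∃ r > (0:ℝ), ∃ R > (0:ℝ), ∀ (z : X) (t : ℝ),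
      ‖z - x‖ < r → R < t → K₁ < H z t) :
    ∃ u : X → ℝ,
      (Continuous u ∧ (∃ C : ℝ, ∀ x, |u x| ≤ C) ∧
        IsViscositySub H u ∧ IsViscositySuper H u) ∧
      (∀ w : X → ℝ, (Continuous w ∧ (∃ C : ℝ, ∀ x, |w x| ≤ C) ∧
        IsViscositySub H w ∧ IsViscositySuper H w) → w = u) ∧
      LocallyLipschitz u ∧
      (∀ x : X, -K₁ ≤ u x ∧ u x ≤ -K₀) ∧
      (∀ x : X, IsLUB {r : ℝ | ∃ w : X → ℝ, IsViscositySub H w ∧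
        (∀ y : X, -K₁ ≤ w y ∧ w y ≤ -K₀) ∧ r = w x} (u x)) := by
  obtain ⟨φ, φ', K, hφ⟩ := hbump.exists_isGauge
  let F : Set (X → ℝ) := {w | IsViscositySub H w ∧ ∀ y, -K₁ ≤ w y ∧ w y ≤ -K₀}
  let S : X → Set ℝ := fun x => {r | ∃ w : X → ℝ, IsViscositySub H w ∧
    (∀ y : X, -K₁ ≤ w y ∧ w y ≤ -K₀) ∧ r = w x}
  let u : X → ℝ := fun x => sSup (S x)
  have hconst : (fun _ => -K₁) ∈ F :=
    ⟨isViscositySub_const fun x => by linarith [(hH0 x).2], fun _ => ⟨le_rfl, by linarith⟩⟩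
  have hSlub : ∀ x, IsLUB (S x) (u x) := fun x =>
    isLUB_csSup ⟨_, _, hconst.1, hconst.2, rfl⟩
      ⟨-K₀, by rintro _ ⟨w, -, hw, rfl⟩; exact (hw x).2⟩
  have hFle : ∀ w ∈ F, ∀ x, w x ≤ u x := fun w hw x => (hSlub x).1 ⟨w, hw.1, hw.2, rfl⟩
  have hle : ∀ x c, (∀ w ∈ F, w x ≤ c) → u x ≤ c := fun x c hc =>
    (hSlub x).2 (by rintro _ ⟨w, hw, hw', rfl⟩; exact hc w ⟨hw, hw'⟩)
  have hbd : ∀ x, -K₁ ≤ u x ∧ u x ≤ -K₀ := fun x =>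
    ⟨hFle _ hconst x, hle x _ fun w hw => (hw.2 x).2⟩
  have hlip : LocallyLipschitz u := by
    intro x₀
    obtain ⟨r, hr, R, hR, hcoer⟩ := hcoer x₀
    obtain ⟨L, hL, hRL, hLr⟩ : ∃ L, 0 ≤ L ∧ R < L ∧ -K₀ - -K₁ + 1 ≤ L * (r / 4) := by
      refine ⟨max (R + 1) ((-K₀ - -K₁ + 1) / (r / 4)), by positivity,
        lt_max_of_lt_left (by linarith), ?_⟩
      rw [← div_le_iff₀ (by positivity)]
      exact le_max_right _ _
    refine ⟨L.toNNReal, Metric.ball x₀ (r / 2), Metric.ball_mem_nhds _ (by positivity), ?_⟩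
    refine LipschitzOnWith.of_le_add_mul _ fun x _ y hy => ?_
    rw [Real.coe_toNNReal _ hL, dist_eq_norm]
    refine hle x _ fun w hw => ?_
    have h1 := le_add_mul_norm_of_norm_superdiff_le hφ hw.1.1 (fun z => (hw.2 z).1)
      (fun z => (hw.2 z).2) (x₀ := x₀) hr hL hRL hLr (fun z hz Δ hΔ => by
        by_contra! h
        linarith [hcoer z ‖Δ‖ hz h, hw.1.2 z Δ hΔ, (hw.2 z).1])
      (y := y) (by simpa [dist_eq_norm] using hy) x
    linarith [hFle w hw y]
  have hcont : Continuous u := hlip.continuous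
  have hsub : IsViscositySub H u := by
    refine isViscositySub_of_forall_exists_lt hφ hHcont (F := F) hcont.upperSemicontinuous
      (fun x => (hbd x).2) (fun w hw => hw.1) hFle fun x ε hε => ?_
    by_contra! h
    linarith [hle x _ h]
  have hsuper : IsViscositySuper H u := by
    refine ⟨hcont.lowerSemicontinuous, fun x₀ Δ hΔ => ?_⟩
    by_contra! hneg
    obtain ⟨w, hw, huw, hlt, M', hM'⟩ :=
      exists_isViscositySub_lt hHcont hcont (fun x => (hbd x).2) hsub hΔ hneg
    have hwK : ∀ x, w x ≤ -K₀ := hw.le_of_isViscositySuper hφ hHA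
      (isViscositySuper_const fun x => by linarith [(hH0 x).1]) hM' (fun _ => le_rfl)
    exact (hFle w ⟨hw, fun y => ⟨(hbd y).1.trans (huw y), hwK y⟩⟩ x₀).not_gt hlt
  refine ⟨u, ⟨hcont, ⟨max |(-K₁)| |(-K₀)|, fun x => abs_le_max_abs_abs (hbd x).1 (hbd x).2⟩,
    hsub, hsuper⟩, ?_, hlip, hbd, hSlub⟩
  rintro w ⟨-, ⟨C, hC⟩, hwsub, hwsuper⟩
  funext x
  exact le_antisymm
    (hwsub.le_of_isViscositySuper hφ hHA hsuper (fun z => (abs_le.1 (hC z)).2)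
      (fun z => (hbd z).1) x)
    (hsub.le_of_isViscositySuper hφ hHA hwsuper (fun z => (hbd z).2)
      (fun z => (abs_le.1 (hC z)).1) x)
end

section
/- Let X be a real Banach space admitting a C¹ Lipschitz bump function and let H₁, H₂ : [0,∞) × X × ℝ → ℝ be continuous Hamiltonians each satisfying the evolution condition (A), with H₁ ≤ H₂ pointwise. Let h₁, h₂ : X → ℝ be bounded continuous with h₂ ≤ h₁. Suppose v is a viscosity supersolution of v_t + H₁(t, x, ‖v_x‖) = 0 with v(0,·) ≥ h₁, u is a viscosity subsolution of u_t + H₂(t, x, ‖u_x‖) = 0 with u(0,·) ≤ h₂, both u and v are bounded on [0,T) × X for every T > 0, and for every (t,x) ∈ (0,∞) × X at least one of u, v is Lipschitz on some neighborhood of (t,x). Then sup_{[0,∞)×X} (u − v) ≤ sup_{[0,∞)×X×ℝ} (H₂ − H₁) + sup_X (h₂ − h₁). -/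
open Filter Topology

variable {X : Type*} [NormedAddCommGroup X] [NormedSpace ℝ X]

/-- The parabolic superdifferential of `u : [0,∞) × X → ℝ` at `(t,x)`. -/
def psuperdiff (u : ℝ → X → ℝ) (t : ℝ) (x : X) : Set (ℝ × (X →L[ℝ] ℝ)) :=
  {p | ∀ ε > (0:ℝ), ∃ δ > (0:ℝ), ∀ (s : ℝ) (k : X), |s| + ‖k‖ < δ → 0 ≤ t + s →
    u (t + s) (x + k) ≤ u t x + p.1 * s + p.2 k + ε * (|s| + ‖k‖)}

/-- The parabolic subdifferential of `u : [0,∞) × X → ℝ` at `(t,x)`. -/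
def psubdiff (u : ℝ → X → ℝ) (t : ℝ) (x : X) : Set (ℝ × (X →L[ℝ] ℝ)) :=
  {p | ∀ ε > (0:ℝ), ∃ δ > (0:ℝ), ∀ (s : ℝ) (k : X), |s| + ‖k‖ < δ → 0 ≤ t + s →
    u t x + p.1 * s + p.2 k - ε * (|s| + ‖k‖) ≤ u (t + s) (x + k)}

/-- The evolution condition (A) for a Hamiltonian `H : [0,∞) × X × ℝ → ℝ`. -/
def CondAEvol (H : ℝ → X → ℝ → ℝ) : Prop :=
  ∃ (C : ℝ) (ω : ℝ → ℝ → ℝ → ℝ), 0 ≤ C ∧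
    ContinuousOn (fun p : ℝ × ℝ × ℝ => ω p.1 p.2.1 p.2.2) {p : ℝ × ℝ × ℝ | 0 ≤ p.1} ∧
    ω 0 0 0 = 0 ∧
    ∀ (t₁ t₂ : ℝ), 0 ≤ t₁ → 0 ≤ t₂ → ∀ (x₁ x₂ : X) (r₁ r₂ : ℝ),
      |H t₁ x₁ r₁ - H t₂ x₂ r₂| ≤
        ω |t₁ - t₂| ‖x₁ - x₂‖ (r₁ - r₂) + C * max |r₁| |r₂| * (|t₁ - t₂| + ‖x₁ - x₂‖)

/-- `u` is a viscosity subsolution of `u_t + H(t, x, ‖u_x‖) = 0` with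
initial condition `u(0,·) ≤ h`. -/
def IsEvolSub (H : ℝ → X → ℝ → ℝ) (h : X → ℝ) (u : ℝ → X → ℝ) : Prop :=
  UpperSemicontinuousOn (fun p : ℝ × X => u p.1 p.2) {p : ℝ × X | 0 ≤ p.1} ∧
  (∀ t : ℝ, 0 < t → ∀ x : X, ∀ p ∈ psuperdiff u t x, p.1 + H t x ‖p.2‖ ≤ 0) ∧
  (∀ x : X, u 0 x ≤ h x)

/-- `v` is a viscosity supersolution of `v_t + H(t, x, ‖v_x‖) = 0` with
initial condition `v(0,·) ≥ h`. -/
def IsEvolSuper (H : ℝ → X → ℝ → ℝ) (h : X → ℝ) (v : ℝ → X → ℝ) : Prop :=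
  LowerSemicontinuousOn (fun p : ℝ × X => v p.1 p.2) {p : ℝ × X | 0 ≤ p.1} ∧
  (∀ t : ℝ, 0 < t → ∀ x : X, ∀ p ∈ psubdiff v t x, 0 ≤ p.1 + H t x ‖p.2‖) ∧
  (∀ x : X, h x ≤ v 0 x)

section Perturbation

variable {E F : Type*} [NormedAddCommGroup E] [NormedSpace ℝ E]
  [NormedAddCommGroup F] [NormedSpace ℝ F]

/-- A nonnegative differentiable function bounded, together with its derivative, by `a`. -/
structure IsSmallPerturbation (a : ℝ) (g : E → ℝ) : Prop where
  nonneg : ∀ x, 0 ≤ g x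
  le : ∀ x, g x ≤ a
  differentiable : Differentiable ℝ g
  norm_fderiv_le : ∀ x, ‖fderiv ℝ g x‖ ≤ a

/-- A differentiable function, small in `C¹` sense, which separates the origin
from the complement of any of its neighborhoods. -/
structure IsGauge_s18 (θ : E → ℝ) : Prop extends IsSmallPerturbation 1 θ where
  map_zero : θ 0 = 0
  coercive : ∀ r > (0 : ℝ), ∃ c > (0 : ℝ), ∀ z, r ≤ ‖z‖ → c ≤ θ z

namespace IsSmallPerturbation

theorem tsum {φ : ℕ → E → ℝ} {a : ℕ → ℝ} {A : ℝ}
    (h : ∀ n, IsSmallPerturbation (a n) (φ n)) (ha : HasSum a A) :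
    IsSmallPerturbation A (fun x => ∑' n, φ n x) ∧ ∀ x, Summable fun n => φ n x := by
  have hs : ∀ x, Summable fun n => φ n x := fun x =>
    Summable.of_nonneg_of_le (fun n => (h n).nonneg x) (fun n => (h n).le x) ha.summable
  have hd : ∀ x, HasFDerivAt (fun y => ∑' n, φ n y) (∑' n, fderiv ℝ (φ n) x) x := fun x =>
    hasFDerivAt_tsum (x₀ := x) ha.summable (fun n x => ((h n).differentiable x).hasFDerivAt)
      (fun n x => (h n).norm_fderiv_le x) (hs x) x
  refine ⟨⟨fun x => tsum_nonneg fun n => (h n).nonneg x, fun x => ?_,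
    fun x => (hd x).differentiableAt, fun x => ?_⟩, hs⟩
  · rw [← ha.tsum_eq]
    exact (hs x).tsum_le_tsum (fun n => (h n).le x) ha.summable
  · rw [(hd x).fderiv]
    exact tsum_of_norm_bounded ha fun n => (h n).norm_fderiv_le x

theorem const_mul {a c : ℝ} {g : E → ℝ} (h : IsSmallPerturbation a g) (hc : 0 ≤ c) :
    IsSmallPerturbation (c * a) (fun x => c * g x) where
  nonneg x := mul_nonneg hc (h.nonneg x)
  le x := mul_le_mul_of_nonneg_left (h.le x) hc
  differentiable := h.differentiable.const_mul c
  norm_fderiv_le x := by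
    rw [fderiv_const_mul (h.differentiable x), norm_smul, Real.norm_of_nonneg hc]
    exact mul_le_mul_of_nonneg_left (h.norm_fderiv_le x) hc

theorem comp_sub {a : ℝ} {g : E → ℝ} (h : IsSmallPerturbation a g) (x₀ : E) :
    IsSmallPerturbation a (fun x => g (x - x₀)) where
  nonneg x := h.nonneg _
  le x := h.le _
  differentiable := h.differentiable.comp (differentiable_id.sub_const x₀)
  norm_fderiv_le x := by
    rw [fderiv_comp_sub]
    exact h.norm_fderiv_le _

end IsSmallPerturbation

/-- The smooth variational principle: an upper semicontinuous function which is bounded above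
attains its maximum after an arbitrarily small differentiable perturbation. -/
theorem IsGauge_s18.exists_perturbed_max [CompleteSpace E] {θ : E → ℝ} (hθ : IsGauge_s18 θ)
    {S : Set E} (hS : IsClosed S) (hne : S.Nonempty) {f : E → ℝ}
    (hf : UpperSemicontinuousOn f S) {B : ℝ} (hB : ∀ x ∈ S, f x ≤ B) {ε : ℝ} (hε : 0 < ε) :
    ∃ g : E → ℝ, IsSmallPerturbation ε g ∧ ∃ x ∈ S, ∀ y ∈ S, f y - g y ≤ f x - g x := by
  choose c hc0 hc using fun n : ℕ => hθ.coercive ((1 / 2 : ℝ) ^ n) (by positivity)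
  set δ : ℕ → ℝ := fun n => ε / 2 / 2 ^ n with hδ
  have hδ0 : ∀ n, 0 < δ n := fun n => by simp only [hδ]; positivity
  have hpick : ∀ (n : ℕ) (A : Set E) (G : E → ℝ), ∃ x, A.Nonempty → BddAbove (G '' A) →
      x ∈ A ∧ ∀ y ∈ A, G y < G x + δ n * c n := by
    intro n A G
    by_cases h : A.Nonempty ∧ BddAbove (G '' A)
    · obtain ⟨hA, hb⟩ := h
      obtain ⟨_, ⟨x, hx, rfl⟩, hlt⟩ := exists_lt_of_lt_csSup (hA.image G)
        (sub_lt_self (sSup (G '' A)) (mul_pos (hδ0 n) (hc0 n)))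
      refine ⟨x, fun _ _ => ⟨hx, fun y hy => ?_⟩⟩
      have := le_csSup hb (Set.mem_image_of_mem G hy)
      linarith
    · exact ⟨0, fun h1 h2 => absurd ⟨h1, h2⟩ h⟩
  choose pick hpick using hpick
  let st : ℕ → Set E × (E → ℝ) := fun n => Nat.rec (S, f) (fun n s =>
    ({y ∈ s.1 | s.2 (pick n s.1 s.2) ≤ s.2 y - δ n * θ (y - pick n s.1 s.2)},
      fun y => s.2 y - δ n * θ (y - pick n s.1 s.2))) n
  set A : ℕ → Set E := fun n => (st n).1
  set G : ℕ → E → ℝ := fun n => (st n).2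
  set x : ℕ → E := fun n => pick n (A n) (G n)
  have hG0 : G 0 = f := rfl
  have hAs : ∀ n, A (n + 1) = {y ∈ A n | G n (x n) ≤ G (n + 1) y} := fun n => rfl
  have hGs : ∀ n y, G (n + 1) y = G n y - δ n * θ (y - x n) := fun n y => rfl
  have hterm : ∀ n y, 0 ≤ δ n * θ (y - x n) := fun n y =>
    mul_nonneg (hδ0 n).le (hθ.nonneg _)
  have hanti : ∀ m n, m ≤ n → A n ⊆ A m := fun m n hmn =>
    antitone_nat_of_succ_le (f := A) (fun n => by rw [hAs]; exact Set.sep_subset _ _) hmn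
  have hsub : ∀ n, A n ⊆ S := fun n => hanti 0 n n.zero_le
  have hGle : ∀ n y, G n y ≤ f y := by
    intro n y
    induction n with
    | zero => exact le_rfl
    | succ n ih => rw [hGs]; linarith [hterm n y]
  have hbdd : ∀ n, BddAbove (G n '' A n) := by
    rintro n
    refine ⟨B, ?_⟩
    rintro _ ⟨y, hy, rfl⟩
    exact (hGle n y).trans (hB y (hsub n hy))
  have hGx : ∀ n, G (n + 1) (x n) = G n (x n) := fun n => by
    rw [hGs, sub_self, hθ.map_zero]; ring
  have hAne : ∀ n, (A n).Nonempty := by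
    intro n
    induction n with
    | zero => exact hne
    | succ n ih => exact ⟨x n, by rw [hAs]; exact ⟨(hpick n _ _ ih (hbdd n)).1, (hGx n).ge⟩⟩
  have hx : ∀ n, x n ∈ A n := fun n => (hpick n _ _ (hAne n) (hbdd n)).1
  have hmax : ∀ n, ∀ y ∈ A n, G n y < G n (x n) + δ n * c n := fun n =>
    (hpick n _ _ (hAne n) (hbdd n)).2
  have hdist : ∀ n, ∀ y ∈ A (n + 1), ‖y - x n‖ < (1 / 2) ^ n := by
    intro n y hy
    rw [hAs] at hy
    by_contra! hcon
    have h1 := mul_le_mul_of_nonneg_left (hc n _ hcon) (hδ0 n).le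
    have h2 := hmax n y hy.1
    have h3 := hy.2
    rw [hGs] at h3
    linarith
  have hcau : CauchySeq x := by
    refine cauchySeq_of_le_geometric (1 / 2) 1 (by norm_num) fun n => ?_
    rw [dist_comm, dist_eq_norm, one_mul]
    exact (hdist n _ (hx (n + 1))).le
  obtain ⟨z, hz⟩ := cauchySeq_tendsto_of_complete hcau
  have hcont : ∀ n, UpperSemicontinuousOn (G n) S := by
    intro n
    induction n with
    | zero => exact hf
    | succ n ih =>
      have h1 : Continuous fun y => -(δ n * θ (y - x n)) :=
        (((hθ.comp_sub (x n)).differentiable.continuous).const_mul (δ n)).neg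
      have := ih.add (h1.upperSemicontinuous.upperSemicontinuousOn S)
      simpa only [← sub_eq_add_neg] using this
  have hzS : z ∈ S := hS.mem_of_tendsto hz (Eventually.of_forall fun n => hsub n (hx n))
  have hzA : ∀ n, z ∈ A n := by
    intro n
    induction n with
    | zero => exact hzS
    | succ n ih =>
      rw [hAs]
      refine ⟨ih, ?_⟩
      by_contra! hcon
      have h1 := hcont (n + 1) z hzS _ hcon
      have h2 : Tendsto x atTop (𝓝[S] z) := tendsto_nhdsWithin_iff.2
        ⟨hz, Eventually.of_forall fun n => hsub n (hx n)⟩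
      obtain ⟨m, hm1, hm2⟩ := ((h2.eventually h1).and (eventually_ge_atTop (n + 1))).exists
      have h3 := hanti _ _ hm2 (hx m)
      rw [hAs] at h3
      exact absurd h3.2 (not_le.2 hm1)
  have hsmall : ∀ n, IsSmallPerturbation (δ n) (fun y => δ n * θ (y - x n)) := fun n => by
    simpa using (hθ.comp_sub (x n)).const_mul (hδ0 n).le
  obtain ⟨hg, hsum⟩ := IsSmallPerturbation.tsum hsmall (hasSum_geometric_two' ε)
  refine ⟨_, hg, z, hzS, ?_⟩
  set g : E → ℝ := fun y => ∑' n, δ n * θ (y - x n)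
  have hGsum : ∀ n y, G n y = f y - ∑ k ∈ Finset.range n, δ k * θ (y - x k) := by
    intro n y
    induction n with
    | zero => simp [hG0]
    | succ n ih => rw [hGs, ih, Finset.sum_range_succ]; ring
  have hGlim : ∀ y, Tendsto (fun n => G n y) atTop (𝓝 (f y - g y)) := by
    intro y
    simp only [hGsum]
    exact tendsto_const_nhds.sub (hsum y).hasSum.tendsto_sum_nat
  have hGge : ∀ n y, f y - g y ≤ G n y := by
    intro n y
    rw [hGsum]
    exact sub_le_sub_left ((hsum y).sum_le_tsum _ fun k _ => hterm k y) _
  have hmono : Monotone fun n => G n (x n) := monotone_nat_of_le_succ fun n => by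
    have := hx (n + 1)
    rw [hAs] at this
    exact this.2
  have hzmax : ∀ n, G n (x n) ≤ f z - g z := by
    intro n
    refine ge_of_tendsto ((tendsto_add_atTop_iff_nat 1).2 (hGlim z)) ?_
    filter_upwards [eventually_ge_atTop n] with m hm
    have := hzA (m + 1)
    rw [hAs] at this
    exact (hmono hm).trans this.2
  intro y hy
  have key : ∀ n, y ∈ A n ∨ f y - g y ≤ f z - g z := by
    intro n
    induction n with
    | zero => exact Or.inl hy
    | succ n ih =>
      rcases ih with ih | ih
      · by_cases h : G n (x n) ≤ G (n + 1) y
        · exact Or.inl (by rw [hAs]; exact ⟨ih, h⟩)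
        · exact Or.inr ((hGge (n + 1) y).trans ((not_le.1 h).le.trans (hzmax n)))
      · exact Or.inr ih
  by_cases h : ∀ n, y ∈ A n
  · have hxy : Tendsto x atTop (𝓝 y) := by
      rw [tendsto_iff_norm_sub_tendsto_zero]
      refine squeeze_zero (fun n => norm_nonneg _) (fun n => ?_)
        (tendsto_pow_atTop_nhds_zero_of_lt_one (r := (1 / 2 : ℝ)) (by norm_num) (by norm_num))
      rw [norm_sub_rev]
      exact (hdist n y (h (n + 1))).le
    rw [tendsto_nhds_unique hz hxy]
  · push Not at h
    obtain ⟨n, hn⟩ := h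
    exact (key n).resolve_left hn

namespace IsSmallPerturbation

theorem comp_clm {a m : ℝ} {g : F → ℝ} (h : IsSmallPerturbation a g) (T : E →L[ℝ] F)
    (hm : 1 ≤ m) (hT : ‖T‖ ≤ m) : IsSmallPerturbation (m * a) (fun x => g (T x)) where
  nonneg x := h.nonneg _
  le x := (h.le _).trans (le_mul_of_one_le_left ((h.nonneg (T x)).trans (h.le _)) hm)
  differentiable := h.differentiable.comp T.differentiable
  norm_fderiv_le x := by
    have hd : HasFDerivAt (fun x => g (T x)) ((fderiv ℝ g (T x)).comp T) x :=
      (h.differentiable (T x)).hasFDerivAt.comp x T.hasFDerivAt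
    rw [hd.fderiv, mul_comm m a]
    exact (ContinuousLinearMap.opNorm_comp_le _ _).trans
      (mul_le_mul (h.norm_fderiv_le _) hT (norm_nonneg _) ((h.nonneg (T x)).trans (h.le _)))

theorem add {a b : ℝ} {f g : E → ℝ} (hf : IsSmallPerturbation a f)
    (hg : IsSmallPerturbation b g) : IsSmallPerturbation (a + b) (fun x => f x + g x) where
  nonneg x := add_nonneg (hf.nonneg x) (hg.nonneg x)
  le x := add_le_add (hf.le x) (hg.le x)
  differentiable := hf.differentiable.add hg.differentiable
  norm_fderiv_le x := by
    rw [fderiv_fun_add (hf.differentiable x) (hg.differentiable x)]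
    exact (norm_add_le _ _).trans (add_le_add (hf.norm_fderiv_le x) (hg.norm_fderiv_le x))

end IsSmallPerturbation

theorem IsGauge_s18.prod {θ₁ : E → ℝ} {θ₂ : F → ℝ} (h₁ : IsGauge_s18 θ₁) (h₂ : IsGauge_s18 θ₂) :
    IsGauge_s18 (fun p : E × F => 1 / 2 * θ₁ p.1 + 1 / 2 * θ₂ p.2) where
  toIsSmallPerturbation := by
    have e₁ := (h₁.comp_clm (ContinuousLinearMap.fst ℝ E F) le_rfl
      (ContinuousLinearMap.norm_fst_le ℝ E F)).const_mul (c := 1 / 2) (by norm_num)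
    have e₂ := (h₂.comp_clm (ContinuousLinearMap.snd ℝ E F) le_rfl
      (ContinuousLinearMap.norm_snd_le ℝ E F)).const_mul (c := 1 / 2) (by norm_num)
    have e₃ := e₁.add e₂
    norm_num at e₃ ⊢
    exact e₃
  map_zero := by simp [h₁.map_zero, h₂.map_zero]
  coercive r hr := by
    obtain ⟨c₁, hc₁, H₁⟩ := h₁.coercive r hr
    obtain ⟨c₂, hc₂, H₂⟩ := h₂.coercive r hr
    refine ⟨1 / 2 * min c₁ c₂, by positivity, fun z hz => ?_⟩
    have n₁ := h₁.nonneg z.1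
    have n₂ := h₂.nonneg z.2
    rcases le_max_iff.1 (Prod.norm_def z ▸ hz) with h | h
    · linarith [H₁ _ h, min_le_left c₁ c₂]
    · linarith [H₂ _ h, min_le_right c₁ c₂]

theorem hasDerivAt_sq_div_one_add_sq (s : ℝ) :
    HasDerivAt (fun s : ℝ => s ^ 2 / (1 + s ^ 2)) (2 * s / (1 + s ^ 2) ^ 2) s := by
  have h1 : HasDerivAt (fun s : ℝ => s ^ 2) (2 * s) s := by simpa using hasDerivAt_pow 2 s
  have h2 := h1.fun_div (h1.const_add 1) (by positivity)
  have h3 : 2 * s * (1 + s ^ 2) - s ^ 2 * (2 * s) = 2 * s := by ring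
  rwa [h3] at h2

theorem abs_deriv_sq_div_one_add_sq_le (s : ℝ) : |2 * s / (1 + s ^ 2) ^ 2| ≤ 1 := by
  rw [abs_div, abs_of_nonneg (by positivity : 0 ≤ (1 + s ^ 2) ^ 2), div_le_one (by positivity),
    abs_le]
  constructor <;> nlinarith [sq_nonneg (s - 1), sq_nonneg (s + 1), sq_nonneg (s ^ 2)]

theorem sq_div_one_add_sq_le_one (s : ℝ) : s ^ 2 / (1 + s ^ 2) ≤ 1 := by
  rw [div_le_one (by positivity)]
  linarith

theorem isGauge_sq_div_one_add_sq : IsGauge_s18 (fun s : ℝ => s ^ 2 / (1 + s ^ 2)) where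
  nonneg s := by positivity
  le := sq_div_one_add_sq_le_one
  differentiable s := (hasDerivAt_sq_div_one_add_sq s).differentiableAt
  norm_fderiv_le s := by
    rw [← norm_deriv_eq_norm_fderiv, (hasDerivAt_sq_div_one_add_sq s).deriv]
    exact abs_deriv_sq_div_one_add_sq_le s
  map_zero := by simp
  coercive r hr := by
    refine ⟨r ^ 2 / (1 + r ^ 2), by positivity, fun z hz => ?_⟩
    have : r ^ 2 ≤ z ^ 2 := by
      rw [← sq_abs z]
      exact pow_le_pow_left₀ hr.le hz 2
    rw [div_le_div_iff₀ (by positivity) (by positivity)]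
    nlinarith

theorem HasC1LipBump.exists_isGauge_s18 (h : HasC1LipBump E) : ∃ θ : E → ℝ, IsGauge_s18 θ := by
  obtain ⟨b, hb, ⟨K, hK⟩, hbd, a, ha⟩ := h
  have ha : b a ≠ 0 := ha
  obtain ⟨R₀, hR₀⟩ := hbd.exists_norm_le
  set R : ℝ := |R₀| + ‖a‖ + 1 with hR
  set D : ℝ := K / |b a| + 1 with hD
  have hD1 : 1 ≤ D := by
    have : (0 : ℝ) ≤ K / |b a| := by positivity
    linarith
  set ψ : E → ℝ := fun z => (1 - b (a + z) / b a) ^ 2 / (1 + (1 - b (a + z) / b a) ^ 2) with hψ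
  have hψd : ∀ z, ∃ T : E →L[ℝ] ℝ, HasFDerivAt ψ T z ∧ ‖T‖ ≤ D := by
    intro z
    have h1 : HasFDerivAt (fun z => b (a + z)) (fderiv ℝ b (a + z)) z := by
      have := (hb.differentiable one_ne_zero (a + z)).hasFDerivAt
      exact (hasFDerivAt_comp_add_left (f := b) a).2 this
    have h2 : HasFDerivAt (fun z => 1 - b (a + z) / b a) (-((b a)⁻¹ • fderiv ℝ b (a + z))) z := by
      have h3 := (h1.const_smul (b a)⁻¹).const_sub 1
      refine h3.congr_of_eventuallyEq (Eventually.of_forall fun y => ?_)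
      simp [div_eq_inv_mul]
    refine ⟨_, (hasDerivAt_sq_div_one_add_sq _).comp_hasFDerivAt z h2, ?_⟩
    rw [norm_smul, norm_neg, norm_smul, norm_inv, Real.norm_eq_abs, Real.norm_eq_abs]
    have h4 : ‖fderiv ℝ b (a + z)‖ ≤ K := norm_fderiv_le_of_lipschitz ℝ hK
    have h5 : |b a|⁻¹ * ‖fderiv ℝ b (a + z)‖ ≤ D := by
      rw [hD, div_eq_inv_mul]
      have := mul_le_mul_of_nonneg_left h4 (inv_nonneg.2 (abs_nonneg (b a)))
      linarith
    exact (mul_le_of_le_one_left (by positivity) (abs_deriv_sq_div_one_add_sq_le _)).trans h5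
  have hψs : IsSmallPerturbation D ψ :=
    { nonneg := fun z => by simp only [hψ]; positivity
      le := fun z => (sq_div_one_add_sq_le_one _).trans hD1
      differentiable := fun z => (hψd z).choose_spec.1.differentiableAt
      norm_fderiv_le := fun z => by
        rw [(hψd z).choose_spec.1.fderiv]
        exact (hψd z).choose_spec.2 }
  have hψ0 : ψ 0 = 0 := by simp [hψ, ha]
  have hψR : ∀ z, R ≤ ‖z‖ → ψ z = 1 / 2 := by
    intro z hz
    have : b (a + z) = 0 := by
      by_contra hne
      have h1 := hR₀ (a + z) hne
      have h2 : ‖z‖ ≤ ‖a + z‖ + ‖a‖ := by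
        simpa using norm_sub_le (a + z) a
      linarith [le_abs_self R₀]
    simp only [hψ, this]
    norm_num
  set φ : ℕ → E → ℝ := fun k z => (1 / (2 * D) * (1 / 4) ^ k) * ψ ((2 : ℝ) ^ k • z) with hφ
  have hφs : ∀ k, IsSmallPerturbation (1 / 2 / 2 ^ k) (φ k) := by
    intro k
    have h1 := (hψs.comp_clm ((2 : ℝ) ^ k • ContinuousLinearMap.id ℝ E)
      (one_le_pow₀ one_le_two : (1 : ℝ) ≤ 2 ^ k) (by
        rw [norm_smul, Real.norm_of_nonneg (by positivity)]
        exact mul_le_of_le_one_right (by positivity) ContinuousLinearMap.norm_id_le)).const_mul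
        (c := 1 / (2 * D) * (1 / 4) ^ k) (by positivity)
    refine (congrArg (fun A => IsSmallPerturbation A (φ k)) ?_).mpr h1
    have h2 : ((1 : ℝ) / 4) ^ k = 1 / 2 ^ k * (1 / 2 ^ k) := by
      rw [div_pow, one_pow, show (4 : ℝ) = 2 * 2 by norm_num, mul_pow]
      field_simp
    rw [h2]
    field_simp
  obtain ⟨hs, hsum⟩ := IsSmallPerturbation.tsum hφs (hasSum_geometric_two' 1)
  refine ⟨_, hs, by simp [hφ, hψ0], fun r hr => ?_⟩
  obtain ⟨k, hk⟩ := pow_unbounded_of_one_lt (R / r) (one_lt_two (α := ℝ))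
  refine ⟨1 / (2 * D) * (1 / 4) ^ k * (1 / 2), by positivity, fun z hz => ?_⟩
  have h1 : R ≤ ‖(2 : ℝ) ^ k • z‖ := by
    rw [norm_smul, Real.norm_of_nonneg (by positivity)]
    rw [div_lt_iff₀ hr] at hk
    exact hk.le.trans (mul_le_mul_of_nonneg_left hz (by positivity))
  have h2 := (hsum z).le_tsum k fun j _ => (hφs j).nonneg z
  simpa only [hφ, hψR _ h1] using h2

/-- `p` is the derivative at `x` of a function touching `U` from above at `x`. -/
def IsSupergradient (U : E → ℝ) (x : E) (p : E →L[ℝ] ℝ) : Prop :=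
  ∃ φ : E → ℝ, HasFDerivAt φ p x ∧ IsLocalMax (fun z => U z - φ z) x

namespace IsSupergradient

theorem of_sub {U a : E → ℝ} {x : E} {p a' : E →L[ℝ] ℝ}
    (h : IsSupergradient (fun z => U z - a z) x p) (ha : HasFDerivAt a a' x) :
    IsSupergradient U x (p + a') := by
  obtain ⟨φ, hφ, hmax⟩ := h
  refine ⟨fun z => φ z + a z, hφ.add ha, ?_⟩
  refine hmax.congr (Eventually.of_forall fun z => ?_)
  ring

theorem eventually_le {U : E → ℝ} {x : E} {p : E →L[ℝ] ℝ} (h : IsSupergradient U x p)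
    {ε : ℝ} (hε : 0 < ε) : ∀ᶠ k in 𝓝 (0 : E), U (x + k) ≤ U x + p k + ε * ‖k‖ := by
  obtain ⟨φ, hφ, hmax⟩ := h
  have hx : Tendsto (fun k : E => x + k) (𝓝 0) (𝓝 x) := by
    simpa using (continuous_const_add x).tendsto (0 : E)
  have h1 := hx.eventually (hφ.isLittleO.def hε)
  filter_upwards [h1, hx.eventually hmax] with k hk1 hk2
  rw [add_sub_cancel_left] at hk1
  have := (le_abs_self _).trans hk1
  linarith

theorem norm_le {U : E → ℝ} {x : E} {p : E →L[ℝ] ℝ} (h : IsSupergradient U x p) {L : ℝ}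
    (hL : 0 ≤ L) (hU : ∀ᶠ z in 𝓝 x, U x - U z ≤ L * ‖z - x‖) : ‖p‖ ≤ L := by
  refine le_of_forall_pos_le_add fun ε hε => ?_
  have hx : Tendsto (fun k : E => x + k) (𝓝 0) (𝓝 x) := by
    simpa using (continuous_const_add x).tendsto (0 : E)
  have h1 : ∀ᶠ k in 𝓝 (0 : E), -p k ≤ (L + ε) * ‖k‖ := by
    filter_upwards [h.eventually_le hε, hx.eventually hU] with k hk1 hk2
    rw [add_sub_cancel_left] at hk2
    linarith
  have hneg : Tendsto (fun k : E => -k) (𝓝 0) (𝓝 0) := by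
    simpa using (continuous_neg (G := E)).tendsto 0
  refine ContinuousLinearMap.opNorm_le_of_nhds_zero (by positivity) ?_
  filter_upwards [h1, hneg.eventually h1] with k hk1 hk2
  rw [map_neg, neg_neg, norm_neg] at hk2
  exact abs_le.2 ⟨by linarith, hk2⟩

end IsSupergradient

/-- A fuzzy sum rule: near a maximum of `U - V` there are almost opposite
supergradients of `U` and `-V`. -/
theorem IsGauge_s18.exists_supergradients [CompleteSpace E] {θ : E → ℝ} (hθ : IsGauge_s18 θ)
    {U V : E → ℝ} {P : E} {R L : ℝ} (hR : 0 < R)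
    (hU : UpperSemicontinuousOn U (Metric.closedBall P R))
    (hV : LowerSemicontinuousOn V (Metric.closedBall P R)) (hL : 0 ≤ L)
    (h : ∀ x ∈ Metric.closedBall P R, ∀ y ∈ Metric.closedBall P R,
      U x - V y ≤ U P - V P + L * ‖x - y‖) {ε : ℝ} (hε : 0 < ε) :
    ∃ x y p q, ‖x - P‖ < ε ∧ ‖y - P‖ < ε ∧ IsSupergradient U x p ∧
      IsSupergradient (fun z => -V z) y q ∧ ‖p + q‖ ≤ ε := by
  set r₀ := min ε R
  have hr₀0 : 0 < r₀ := lt_min hε hR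
  obtain ⟨c, hc, hcθ⟩ := hθ.coercive (r₀ / 2) (by positivity)
  set τ := ε / 4 * c with hτ
  have hτ0 : 0 < τ := by positivity
  set r := min (r₀ / 2) (τ / (3 * (L + 1))) with hr
  have hr0 : 0 < r := by positivity
  set ε₂ := min (ε / 4) (τ / 3)
  have hε₂0 : 0 < ε₂ := by positivity
  obtain ⟨c', hc', hcθ'⟩ := hθ.coercive r hr0
  set n := (L * (2 * R) + ε₂) / c' + 1 with hn
  have hn0 : 0 < n := by positivity
  set S := Metric.closedBall P R ×ˢ Metric.closedBall P R
  have hP : P ∈ Metric.closedBall P R := Metric.mem_closedBall_self hR.le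
  set f : E × E → ℝ := fun z =>
    U z.1 + -V z.2 + -(ε / 4 * θ (z.1 - P) + n * θ (z.1 - z.2)) with hf
  have hθc : Continuous θ := hθ.differentiable.continuous
  have hfusc : UpperSemicontinuousOn f S := by
    have h1 : UpperSemicontinuousOn (fun z : E × E => U z.1) S :=
      hU.comp continuous_fst.continuousOn fun z hz => hz.1
    have h2 : UpperSemicontinuousOn (fun z : E × E => -V z.2) S := by
      have hV' : UpperSemicontinuousOn (fun z => -V z) (Metric.closedBall P R) := by
        intro x hx y hy
        filter_upwards [hV x hx (-y) (by linarith)] with z hz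
        linarith
      exact hV'.comp continuous_snd.continuousOn fun z hz => hz.2
    have h3 : Continuous fun z : E × E => -(ε / 4 * θ (z.1 - P) + n * θ (z.1 - z.2)) := by
      fun_prop
    exact (h1.add h2).add (h3.upperSemicontinuous.upperSemicontinuousOn S)
  have hdiam : ∀ x ∈ Metric.closedBall P R, ∀ y ∈ Metric.closedBall P R, ‖x - y‖ ≤ 2 * R := by
    intro x hx y hy
    rw [← dist_eq_norm]
    have := dist_triangle_right x y P
    linarith [Metric.mem_closedBall.1 hx, Metric.mem_closedBall.1 hy]
  have hfle : ∀ z ∈ S, f z ≤ U P - V P + L * ‖z.1 - z.2‖ -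
      ε / 4 * θ (z.1 - P) - n * θ (z.1 - z.2) := by
    intro z hz
    have := h z.1 hz.1 z.2 hz.2
    simp only [hf]
    linarith
  have hfB : ∀ z ∈ S, f z ≤ U P - V P + L * (2 * R) := by
    intro z hz
    have h1 := hfle z hz
    have h2 := mul_le_mul_of_nonneg_left (hdiam z.1 hz.1 z.2 hz.2) hL
    have h3 := mul_nonneg (by positivity : 0 ≤ ε / 4) (hθ.nonneg (z.1 - P))
    have h4 := mul_nonneg hn0.le (hθ.nonneg (z.1 - z.2))
    linarith
  obtain ⟨g, hg, ⟨x, y⟩, hxy, hmax⟩ := (hθ.prod hθ).exists_perturbed_max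
    (Metric.isClosed_closedBall.prod Metric.isClosed_closedBall) ⟨(P, P), hP, hP⟩ hfusc hfB hε₂0
  have hineq : n * θ (x - y) + ε / 4 * θ (x - P) ≤ L * ‖x - y‖ + ε₂ := by
    have h1 := hmax (P, P) ⟨hP, hP⟩
    have h2 := hfle (x, y) hxy
    have h3 : f (P, P) = U P - V P := by simp [hf, hθ.map_zero]; ring
    linarith [hg.nonneg (x, y), hg.le (P, P)]
  have hxyr : ‖x - y‖ < r := by
    by_contra! hcon
    have h1 := mul_le_mul_of_nonneg_left (hcθ' _ hcon) hn0.le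
    have h2 := mul_le_mul_of_nonneg_left (hdiam x hxy.1 y hxy.2) hL
    have h3 := mul_nonneg (by positivity : 0 ≤ ε / 4) (hθ.nonneg (x - P))
    have h4 : n * c' = L * (2 * R) + ε₂ + c' := by
      rw [hn]
      field_simp
    linarith
  have hxP : ‖x - P‖ < r₀ / 2 := by
    by_contra! hcon
    have h1 := mul_le_mul_of_nonneg_left (hcθ _ hcon) (by positivity : 0 ≤ ε / 4)
    have h2 := mul_nonneg hn0.le (hθ.nonneg (x - y))
    have h3 : L * ‖x - y‖ ≤ τ / 3 := by
      calc L * ‖x - y‖ ≤ (L + 1) * (τ / (3 * (L + 1))) :=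
            mul_le_mul (by linarith) (hxyr.le.trans (min_le_right _ _)) (norm_nonneg _)
              (by linarith)
        _ = τ / 3 := by field_simp
    linarith [min_le_right (ε / 4) (τ / 3)]
  have hyP : ‖y - P‖ < r₀ := by
    have h1 : ‖y - P‖ ≤ ‖x - y‖ + ‖x - P‖ := by
      rw [norm_sub_rev x y]
      exact norm_sub_le_norm_sub_add_norm_sub y x P
    linarith [hxyr.trans_le (min_le_left _ _)]
  have hxP' : ‖x - P‖ < r₀ := by linarith
  have hnhds : ∀ z, ‖z - P‖ < r₀ → Metric.closedBall P R ∈ 𝓝 z := fun z hz => by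
    refine mem_of_superset (Metric.isOpen_ball.mem_nhds ?_) Metric.ball_subset_closedBall
    rw [Metric.mem_ball, dist_eq_norm]
    exact hz.trans_le (min_le_right _ _)
  have hθd : ∀ z, HasFDerivAt θ (fderiv ℝ θ z) z := fun z => (hθ.differentiable z).hasFDerivAt
  set G := fderiv ℝ g (x, y)
  have hGd : HasFDerivAt g G (x, y) := (hg.differentiable _).hasFDerivAt
  have hGn : ‖G‖ ≤ ε₂ := hg.norm_fderiv_le _
  refine ⟨x, y,
    (ε / 4) • fderiv ℝ θ (x - P) + n • fderiv ℝ θ (x - y) +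
      G.comp (ContinuousLinearMap.inl ℝ E E),
    -(n • fderiv ℝ θ (x - y)) + G.comp (ContinuousLinearMap.inr ℝ E E),
    hxP'.trans_le (min_le_left _ _), hyP.trans_le (min_le_left _ _), ?_, ?_, ?_⟩
  · refine ⟨fun z => ε / 4 * θ (z - P) + n * θ (z - y) + g (z, y), ?_, ?_⟩
    · refine HasFDerivAt.add (HasFDerivAt.add ?_ ?_) ?_
      · exact ((hasFDerivAt_comp_sub (f := θ) P).2 (hθd _)).const_mul _
      · exact ((hasFDerivAt_comp_sub (f := θ) y).2 (hθd _)).const_mul _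
      · exact hGd.comp x (hasFDerivAt_prodMk_left x y)
    · filter_upwards [hnhds x hxP'] with z hz
      have := hmax (z, y) ⟨hz, hxy.2⟩
      simp only [hf] at this
      linarith
  · refine ⟨fun z => n * θ (x - z) + g (x, z), ?_, ?_⟩
    · refine HasFDerivAt.add ?_ ?_
      · have h1 : HasFDerivAt (fun z => x - z) (-ContinuousLinearMap.id ℝ E) y :=
          (hasFDerivAt_id y).const_sub x
        have h2 : HasFDerivAt (fun z => n * θ (x - z))
            (n • (fderiv ℝ θ (x - y)).comp (-ContinuousLinearMap.id ℝ E)) y :=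
          ((hθd (x - y)).comp y h1).const_mul n
        have h3 : n • (fderiv ℝ θ (x - y)).comp (-ContinuousLinearMap.id ℝ E) =
            -(n • fderiv ℝ θ (x - y)) := by
          ext; simp
        rwa [h3] at h2
      · exact hGd.comp y (hasFDerivAt_prodMk_right x y)
    · filter_upwards [hnhds y hyP] with z hz
      have := hmax (x, z) ⟨hxy.1, hz⟩
      simp only [hf] at this
      linarith
  · have h1 : ‖(ε / 4) • fderiv ℝ θ (x - P)‖ ≤ ε / 4 := by
      rw [norm_smul, Real.norm_of_nonneg (by positivity)]
      exact mul_le_of_le_one_right (by positivity) (hθ.norm_fderiv_le _)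
    have h2 : ‖G.comp (ContinuousLinearMap.inl ℝ E E)‖ ≤ ε₂ :=
      ((ContinuousLinearMap.opNorm_comp_le _ _).trans (mul_le_of_le_one_right (norm_nonneg _)
        (ContinuousLinearMap.norm_inl_le_one ℝ E E))).trans hGn
    have h3 : ‖G.comp (ContinuousLinearMap.inr ℝ E E)‖ ≤ ε₂ :=
      ((ContinuousLinearMap.opNorm_comp_le _ _).trans (mul_le_of_le_one_right (norm_nonneg _)
        (ContinuousLinearMap.norm_inr_le_one ℝ E E))).trans hGn
    calc _ = ‖(ε / 4) • fderiv ℝ θ (x - P) + G.comp (ContinuousLinearMap.inl ℝ E E) +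
          G.comp (ContinuousLinearMap.inr ℝ E E)‖ := by congr 1; abel
      _ ≤ ε / 4 + ε₂ + ε₂ := (norm_add₃_le).trans (by linarith)
      _ ≤ ε := by linarith [min_le_left (ε / 4) (τ / 3)]

/-- A fuzzy sum rule at a maximum of `U - V - a`, where `a` is differentiable and one of
`U`, `V` is Lipschitz. -/
theorem IsGauge_s18.exists_supergradients_sub [CompleteSpace E] {θ : E → ℝ} (hθ : IsGauge_s18 θ)
    {U V a : E → ℝ} {P : E} {R L : ℝ} (hR : 0 < R)
    (hU : UpperSemicontinuousOn U (Metric.closedBall P R))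
    (hV : LowerSemicontinuousOn V (Metric.closedBall P R)) (ha : Differentiable ℝ a) (hL : 0 ≤ L)
    (hmax : ∀ x ∈ Metric.closedBall P R, U x - V x - a x ≤ U P - V P - a P)
    (hLip : (∀ x ∈ Metric.closedBall P R, ∀ y ∈ Metric.closedBall P R,
        |U x - U y| ≤ L * ‖x - y‖) ∨
      (∀ x ∈ Metric.closedBall P R, ∀ y ∈ Metric.closedBall P R, |V x - V y| ≤ L * ‖x - y‖))
    {ε : ℝ} (hε : 0 < ε) :
    ∃ x y z p q, ‖x - P‖ < ε ∧ ‖y - P‖ < ε ∧ ‖z - P‖ < ε ∧ IsSupergradient U x p ∧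
      IsSupergradient (fun z => -V z) y q ∧ ‖p + q - fderiv ℝ a z‖ ≤ ε ∧
      (‖p‖ ≤ L ∨ ‖q‖ ≤ L) := by
  have hε' : 0 < min ε R := lt_min hε hR
  have hnhds : ∀ z, ‖z - P‖ < min ε R → Metric.closedBall P R ∈ 𝓝 z := fun z hz => by
    refine mem_of_superset (Metric.isOpen_ball.mem_nhds ?_) Metric.ball_subset_closedBall
    rw [Metric.mem_ball, dist_eq_norm]
    exact hz.trans_le (min_le_right _ _)
  have had : ∀ z, HasFDerivAt a (fderiv ℝ a z) z := fun z => (ha z).hasFDerivAt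
  rcases hLip with hLip | hLip
  · obtain ⟨x, y, p, q, hx, hy, hp, hq, hpq⟩ := hθ.exists_supergradients (U := U)
      (V := fun z => V z + a z) hR hU
      (hV.add (ha.continuous.lowerSemicontinuous.lowerSemicontinuousOn _)) hL
      (fun x hx y hy => by
        have h1 := hmax y hy
        have h2 := (le_abs_self _).trans (hLip x hx y hy)
        linarith) hε'
    have hq' : IsSupergradient (fun z => -V z) y (q + fderiv ℝ a y) := by
      refine IsSupergradient.of_sub ?_ (had y)
      simpa only [neg_add, ← sub_eq_add_neg] using hq
    refine ⟨x, y, y, p, q + fderiv ℝ a y, hx.trans_le (min_le_left _ _),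
      hy.trans_le (min_le_left _ _), hy.trans_le (min_le_left _ _), hp, hq', ?_, Or.inl ?_⟩
    · rw [← add_assoc, add_sub_cancel_right]
      exact hpq.trans (min_le_left _ _)
    · refine hp.norm_le hL ?_
      filter_upwards [hnhds x hx] with z hz
      rw [norm_sub_rev]
      exact (le_abs_self _).trans (hLip x (mem_of_mem_nhds (hnhds x hx)) z hz)
  · obtain ⟨x, y, p, q, hx, hy, hp, hq, hpq⟩ := hθ.exists_supergradients
      (U := fun z => U z + -a z) (V := V) hR
      (hU.add (ha.continuous.neg.upperSemicontinuous.upperSemicontinuousOn _)) hV hL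
      (fun x hx y hy => by
        have h1 := hmax x hx
        have h2 := (le_abs_self _).trans (hLip x hx y hy)
        linarith) hε'
    have hp' : IsSupergradient U x (p + fderiv ℝ a x) := by
      refine IsSupergradient.of_sub ?_ (had x)
      simpa only [← sub_eq_add_neg] using hp
    refine ⟨x, y, x, p + fderiv ℝ a x, q, hx.trans_le (min_le_left _ _),
      hy.trans_le (min_le_left _ _), hx.trans_le (min_le_left _ _), hp', hq, ?_, Or.inr ?_⟩
    · rw [add_right_comm, add_sub_cancel_right]
      exact hpq.trans (min_le_left _ _)
    · refine hq.norm_le hL ?_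
      filter_upwards [hnhds y hy] with z hz
      have := (neg_le_abs _).trans (hLip y (mem_of_mem_nhds (hnhds y hy)) z hz)
      rw [norm_sub_rev]
      linarith

theorem IsSupergradient.mem_psuperdiff {u : ℝ → E → ℝ} {P : ℝ × E} {p : ℝ × E →L[ℝ] ℝ}
    (h : IsSupergradient (fun z : ℝ × E => u z.1 z.2) P p) :
    (p (1, 0), p.comp (ContinuousLinearMap.inr ℝ ℝ E)) ∈ psuperdiff u P.1 P.2 := by
  intro ε hε
  obtain ⟨δ, hδ, H⟩ := Metric.eventually_nhds_iff.1 (h.eventually_le hε)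
  refine ⟨δ, hδ, fun s k hsk _ => ?_⟩
  have h1 : ‖(s, k)‖ ≤ |s| + ‖k‖ :=
    max_le (le_add_of_nonneg_right (norm_nonneg k)) (le_add_of_nonneg_left (abs_nonneg s))
  have h2 := H (y := (s, k)) (by rw [dist_zero_right]; exact h1.trans_lt hsk)
  have h3 : p (s, k) = p (1, 0) * s + p (0, k) := by
    have h4 : ((s, k) : ℝ × E) = s • (1, 0) + (0, k) := by simp
    rw [h4, map_add, map_smul, smul_eq_mul, mul_comm]
  have h5 := mul_le_mul_of_nonneg_left h1 hε.le
  simp only [Prod.fst_add, Prod.snd_add] at h2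
  simp only [ContinuousLinearMap.comp_apply, ContinuousLinearMap.inr_apply]
  linarith

theorem neg_mem_psubdiff {v : ℝ → E → ℝ} {t : ℝ} {x : E} {p : ℝ × (E →L[ℝ] ℝ)}
    (h : p ∈ psuperdiff (fun t x => -v t x) t x) : -p ∈ psubdiff v t x := by
  intro ε hε
  obtain ⟨δ, hδ, H⟩ := h ε hε
  refine ⟨δ, hδ, fun s k hsk hs => ?_⟩
  have := H s k hsk hs
  simp only [Prod.fst_neg, Prod.snd_neg, neg_apply, neg_mul]
  linarith

end Perturbation

theorem exists_steep_exp {η K t₀ : ℝ} (hη : 0 < η) :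
    ∃ (lam σ : ℝ), 0 < σ ∧ K ≤ η * Real.exp lam ∧
      ∀ t, 0 ≤ t → σ ≤ η * (Real.exp (lam * (t - t₀)) * lam) := by
  set lam := |K| / η + 1 with hlam
  have hlam0 : 0 < lam := by positivity
  refine ⟨lam, η * (Real.exp (lam * (0 - t₀)) * lam), by positivity, ?_, fun t ht => ?_⟩
  · have h1 : η * lam = |K| + η := by rw [hlam]; field_simp
    have h2 := mul_le_mul_of_nonneg_left (Real.add_one_le_exp lam) hη.le
    linarith [le_abs_self K]
  · gcongr

/-- The comparison principle for bounded sub- and supersolutions, one of which is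
locally Lipschitz near every point. -/
theorem evolution_comparison [CompleteSpace X] {θ : X → ℝ} (hθ : IsGauge_s18 θ)
    {H : ℝ → X → ℝ → ℝ} (hA : CondAEvol H) {u v : ℝ → X → ℝ}
    (husc : UpperSemicontinuousOn (fun p : ℝ × X => u p.1 p.2) {p : ℝ × X | 0 ≤ p.1})
    (hlsc : LowerSemicontinuousOn (fun p : ℝ × X => v p.1 p.2) {p : ℝ × X | 0 ≤ p.1})
    (hu : ∀ t : ℝ, 0 < t → ∀ x : X, ∀ p ∈ psuperdiff u t x, p.1 + H t x ‖p.2‖ ≤ 0)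
    (hv : ∀ t : ℝ, 0 < t → ∀ x : X, ∀ p ∈ psubdiff v t x, 0 ≤ p.1 + H t x ‖p.2‖)
    (hbdd : ∀ T > (0:ℝ), ∃ C : ℝ, ∀ t : ℝ, 0 ≤ t → t < T → ∀ x : X,
      |u t x| ≤ C ∧ |v t x| ≤ C)
    (hLip : ∀ t : ℝ, 0 < t → ∀ x : X,
      (∃ δ > (0:ℝ), ∃ K : ℝ, ∀ (s s' : ℝ) (y y' : X), 0 ≤ s → 0 ≤ s' →
        |s - t| + ‖y - x‖ < δ → |s' - t| + ‖y' - x‖ < δ →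
        |u s y - u s' y'| ≤ K * (|s - s'| + ‖y - y'‖)) ∨
      (∃ δ > (0:ℝ), ∃ K : ℝ, ∀ (s s' : ℝ) (y y' : X), 0 ≤ s → 0 ≤ s' →
        |s - t| + ‖y - x‖ < δ → |s' - t| + ‖y' - x‖ < δ →
        |v s y - v s' y'| ≤ K * (|s - s'| + ‖y - y'‖)))
    {M : ℝ} (hM : ∀ x, u 0 x - v 0 x ≤ M) {t₀ : ℝ} (ht₀ : 0 ≤ t₀) (x₀ : X) :
    u t₀ x₀ - v t₀ x₀ ≤ M := by
  by_contra! hcon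
  obtain ⟨γ, hγ, hγM⟩ : ∃ γ > 0, u t₀ x₀ - v t₀ x₀ = M + 2 * γ :=
    ⟨(u t₀ x₀ - v t₀ x₀ - M) / 2, by linarith, by ring⟩
  obtain ⟨B, hB⟩ := hbdd (t₀ + 2) (by linarith)
  have hη : 0 < γ / 2 := by positivity
  obtain ⟨lam, σ, hσ, hlam, hσle⟩ := exists_steep_exp (K := 2 * B - M) (t₀ := t₀) hη
  obtain ⟨C, ω, hC, hω, hω0, hHA⟩ := hA
  obtain ⟨κ, hκ, hκω⟩ : ∃ κ > 0, ∀ a b c : ℝ, 0 ≤ a → a < κ → |b| < κ → |c| < κ →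
      ω a b c < σ / 4 := by
    have h1 := hω (0, 0, 0) (by simp)
    have h2 := h1.eventually (gt_mem_nhds (show ω 0 0 0 < σ / 4 by rw [hω0]; positivity))
    obtain ⟨κ, hκ, H⟩ := Metric.eventually_nhds_iff.1 (eventually_nhdsWithin_iff.1 h2)
    refine ⟨κ, hκ, fun a b c ha haκ hb hc => H (y := (a, b, c)) ?_ ha⟩
    simp only [Prod.dist_eq, Real.dist_eq, sub_zero]
    exact max_lt (by rwa [abs_of_nonneg ha]) (max_lt hb hc)
  set ε₁ := min (min (γ / 2) 1) (min (σ / 16) (κ / 4))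
  have hε₁0 : 0 < ε₁ := by positivity
  have hε₁γ : ε₁ ≤ γ / 2 := (min_le_left _ _).trans (min_le_left _ _)
  have hε₁1 : ε₁ ≤ 1 := (min_le_left _ _).trans (min_le_right _ _)
  have hε₁σ : ε₁ ≤ σ / 16 := (min_le_right _ _).trans (min_le_left _ _)
  have hε₁κ : ε₁ ≤ κ / 4 := (min_le_right _ _).trans (min_le_right _ _)
  set ρ : ℝ × X → ℝ := fun P => γ / 2 * Real.exp (lam * (P.1 - t₀)) with hρ
  have hρ0 : ∀ P, 0 < ρ P := fun P => by simp only [hρ]; positivity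
  have hρd : ∀ P, HasFDerivAt ρ ((γ / 2 * (Real.exp (lam * (P.1 - t₀)) * lam)) •
      ContinuousLinearMap.fst ℝ ℝ X) P := by
    intro P
    have h1 : HasDerivAt (fun t : ℝ => γ / 2 * Real.exp (lam * (t - t₀)))
        (γ / 2 * (Real.exp (lam * (P.1 - t₀)) * lam)) P.1 := by
      have h2 : HasDerivAt (fun t : ℝ => lam * (t - t₀)) lam P.1 := by
        simpa using ((hasDerivAt_id P.1).sub_const t₀).const_mul lam
      exact h2.exp.const_mul _
    exact h1.comp_hasFDerivAt P hasFDerivAt_fst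
  have hρdiff : Differentiable ℝ ρ := fun P => (hρd P).differentiableAt
  set S : Set (ℝ × X) := {P | 0 ≤ P.1} ∩ {P | P.1 ≤ t₀ + 1}
  have hSc : IsClosed S := (isClosed_le continuous_const continuous_fst).inter
    (isClosed_le continuous_fst continuous_const)
  have hVneg : UpperSemicontinuousOn (fun P : ℝ × X => -v P.1 P.2) {P | 0 ≤ P.1} := by
    intro P hP y hy
    filter_upwards [hlsc P hP (-y) (by linarith)] with z hz
    linarith
  have hfusc : UpperSemicontinuousOn (fun P : ℝ × X => u P.1 P.2 + -v P.1 P.2 + -ρ P) S :=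
    ((husc.add hVneg).mono Set.inter_subset_left).add
      (hρdiff.continuous.neg.upperSemicontinuous.upperSemicontinuousOn S)
  have huvB : ∀ P ∈ S, u P.1 P.2 - v P.1 P.2 ≤ 2 * B := by
    intro P hP
    have hP2 : P.1 ≤ t₀ + 1 := hP.2
    obtain ⟨h1, h2⟩ := hB P.1 hP.1 (by linarith) P.2
    linarith [(abs_le.1 h1).2, (abs_le.1 h2).1]
  have hgauge := isGauge_sq_div_one_add_sq.prod hθ
  have ht₀S : (t₀, x₀) ∈ S := ⟨ht₀, by simp⟩
  obtain ⟨g, hg, P, hPS, hPmax⟩ := hgauge.exists_perturbed_max hSc ⟨_, ht₀S⟩ hfusc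
    (B := 2 * B) (fun P hP => by linarith [huvB P hP, hρ0 P]) hε₁0
  have hPM : M + γ ≤ u P.1 P.2 - v P.1 P.2 - ρ P := by
    have h1 := hPmax _ ht₀S
    have h2 : ρ (t₀, x₀) = γ / 2 := by simp [hρ]
    rw [h2] at h1
    simp only at h1
    linarith [hg.le (t₀, x₀), hg.nonneg P]
  have hP0 : 0 < P.1 := by
    refine lt_of_le_of_ne hPS.1 fun h => ?_
    have h1 := hM P.2
    rw [h] at h1
    linarith [hρ0 P]
  have hP1 : P.1 < t₀ + 1 := by
    refine lt_of_le_of_ne hPS.2 fun h => ?_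
    have h1 : ρ P = γ / 2 * Real.exp lam := by simp [hρ, h]
    linarith [huvB P hPS]
  obtain ⟨R, L, hR, hL, hRS, hLip'⟩ : ∃ R L : ℝ, 0 < R ∧ 0 ≤ L ∧
      (∀ Q ∈ Metric.closedBall P R, 0 < Q.1 ∧ Q.1 < t₀ + 1) ∧
      ((∀ x ∈ Metric.closedBall P R, ∀ y ∈ Metric.closedBall P R,
        |u x.1 x.2 - u y.1 y.2| ≤ L * ‖x - y‖) ∨
      (∀ x ∈ Metric.closedBall P R, ∀ y ∈ Metric.closedBall P R,
        |v x.1 x.2 - v y.1 y.2| ≤ L * ‖x - y‖)) := by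
    have key : ∀ w : ℝ → X → ℝ, (∃ δ > (0:ℝ), ∃ K : ℝ, ∀ (s s' : ℝ) (y y' : X), 0 ≤ s → 0 ≤ s' →
        |s - P.1| + ‖y - P.2‖ < δ → |s' - P.1| + ‖y' - P.2‖ < δ →
        |w s y - w s' y'| ≤ K * (|s - s'| + ‖y - y'‖)) → ∃ R L : ℝ, 0 < R ∧ 0 ≤ L ∧
      (∀ Q ∈ Metric.closedBall P R, 0 < Q.1 ∧ Q.1 < t₀ + 1) ∧
      (∀ x ∈ Metric.closedBall P R, ∀ y ∈ Metric.closedBall P R,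
        |w x.1 x.2 - w y.1 y.2| ≤ L * ‖x - y‖) := by
      rintro w ⟨δ, hδ, K, hK⟩
      have hm : 0 < min δ (min P.1 (t₀ + 1 - P.1)) := lt_min hδ (lt_min hP0 (by linarith))
      set R := min δ (min P.1 (t₀ + 1 - P.1)) / 4 with hR
      have hR1 : 4 * R ≤ δ := by rw [hR]; linarith [min_le_left δ (min P.1 (t₀ + 1 - P.1))]
      have hR2 : 4 * R ≤ P.1 := by
        rw [hR]
        linarith [(min_le_right δ (min P.1 (t₀ + 1 - P.1))).trans (min_le_left _ _)]
      have hR3 : 4 * R ≤ t₀ + 1 - P.1 := by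
        rw [hR]
        linarith [(min_le_right δ (min P.1 (t₀ + 1 - P.1))).trans (min_le_right _ _)]
      have hR0 : 0 < R := by positivity
      have hball : ∀ Q ∈ Metric.closedBall P R, |Q.1 - P.1| ≤ R ∧ ‖Q.2 - P.2‖ ≤ R := by
        intro Q hQ
        rw [Metric.mem_closedBall, dist_eq_norm] at hQ
        exact ⟨(norm_fst_le (Q - P)).trans hQ, (norm_snd_le (Q - P)).trans hQ⟩
      have hin : ∀ Q ∈ Metric.closedBall P R, 0 < Q.1 ∧ Q.1 < t₀ + 1 := by
        intro Q hQ
        have := abs_le.1 (hball Q hQ).1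
        constructor <;> linarith
      refine ⟨R, 2 * |K|, hR0, by positivity, hin, fun x hx y hy => ?_⟩
      have h1 := hball x hx
      have h2 := hball y hy
      refine (hK x.1 y.1 x.2 y.2 (hin x hx).1.le (hin y hy).1.le (by linarith)
        (by linarith)).trans ?_
      have h3 : |x.1 - y.1| + ‖x.2 - y.2‖ ≤ 2 * ‖x - y‖ := by
        have h4 : |x.1 - y.1| ≤ ‖x - y‖ := norm_fst_le (x - y)
        have h5 : ‖x.2 - y.2‖ ≤ ‖x - y‖ := norm_snd_le (x - y)
        linarith
      calc _ ≤ |K| * (2 * ‖x - y‖) :=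
            mul_le_mul (le_abs_self K) h3 (by positivity) (abs_nonneg K)
        _ = _ := by ring
    rcases hLip P.1 hP0 P.2 with h | h
    · obtain ⟨R, L, h1, h2, h3, h4⟩ := key u h
      exact ⟨R, L, h1, h2, h3, Or.inl h4⟩
    · obtain ⟨R, L, h1, h2, h3, h4⟩ := key v h
      exact ⟨R, L, h1, h2, h3, Or.inr h4⟩
  have hpos : Metric.closedBall P R ⊆ {p : ℝ × X | 0 ≤ p.1} := fun Q hQ => (hRS Q hQ).1.le
  obtain ⟨ε, hε, hεε₁, hεR, hεC⟩ : ∃ ε > 0, ε ≤ ε₁ ∧ ε ≤ R ∧ C * (L + 2) * (4 * ε) ≤ σ / 4 := by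
    refine ⟨min (min ε₁ R) (σ / (16 * (C * (L + 2) + 1))), by positivity,
      (min_le_left _ _).trans (min_le_left _ _), (min_le_left _ _).trans (min_le_right _ _), ?_⟩
    calc _ ≤ (C * (L + 2) + 1) * (4 * (σ / (16 * (C * (L + 2) + 1)))) := by
          gcongr
          · linarith
          · exact min_le_right _ _
      _ = σ / 4 := by field_simp; norm_num
  obtain ⟨Q, Q', Z, p, q, hQ, hQ', hZ, hp, hq, hpq, hpL⟩ := hgauge.exists_supergradients_sub
    (U := fun P : ℝ × X => u P.1 P.2) (V := fun P : ℝ × X => v P.1 P.2)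
    (a := fun P => ρ P + g P) hR (husc.mono hpos) (hlsc.mono hpos)
    (hρdiff.add hg.differentiable) hL (fun x hx => by
      have := hPmax x ⟨hpos hx, (hRS x hx).2.le⟩
      linarith) hLip' hε
  have hball : ∀ Q, ‖Q - P‖ < ε → Q ∈ Metric.closedBall P R := fun Q hQ => by
    rw [Metric.mem_closedBall, dist_eq_norm]
    linarith
  have hda : fderiv ℝ (fun P => ρ P + g P) Z = (γ / 2 * (Real.exp (lam * (Z.1 - t₀)) * lam)) •
      ContinuousLinearMap.fst ℝ ℝ X + fderiv ℝ g Z :=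
    ((hρd Z).add (hg.differentiable Z).hasFDerivAt).fderiv
  rw [hda] at hpq
  set D := p + q - ((γ / 2 * (Real.exp (lam * (Z.1 - t₀)) * lam)) •
      ContinuousLinearMap.fst ℝ ℝ X + fderiv ℝ g Z) with hD
  have hpqD : p + q = D + ((γ / 2 * (Real.exp (lam * (Z.1 - t₀)) * lam)) •
      ContinuousLinearMap.fst ℝ ℝ X + fderiv ℝ g Z) := by rw [hD]; abel
  have hgZ := hg.norm_fderiv_le Z
  have htime : σ - 2 * ε₁ ≤ p (1, 0) + q (1, 0) := by
    have h1 : p (1, 0) + q (1, 0) = D (1, 0) + (γ / 2 * (Real.exp (lam * (Z.1 - t₀)) * lam) +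
        fderiv ℝ g Z (1, 0)) := by
      have := congrArg (fun A : ℝ × X →L[ℝ] ℝ => A (1, 0)) hpqD
      simpa using this
    have hn : ‖((1 : ℝ), (0 : X))‖ = 1 := by simp [Prod.norm_def]
    have h2 : |D (1, 0)| ≤ ‖D‖ := by simpa [hn] using D.le_opNorm (1, 0)
    have h3 : |fderiv ℝ g Z (1, 0)| ≤ ‖fderiv ℝ g Z‖ := by
      simpa [hn] using (fderiv ℝ g Z).le_opNorm (1, 0)
    linarith [hσle Z.1 (hRS Z (hball Z hZ)).1.le, (abs_le.1 h2).1, (abs_le.1 h3).1]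
  set r := ‖p.comp (ContinuousLinearMap.inr ℝ ℝ X)‖
  set r' := ‖q.comp (ContinuousLinearMap.inr ℝ ℝ X)‖
  have hcomp : ∀ A : ℝ × X →L[ℝ] ℝ, ‖A.comp (ContinuousLinearMap.inr ℝ ℝ X)‖ ≤ ‖A‖ := fun A =>
    (ContinuousLinearMap.opNorm_comp_le _ _).trans (mul_le_of_le_one_right (norm_nonneg _)
        (ContinuousLinearMap.norm_inr_le_one ℝ ℝ X))
  have hrr : |r' - r| ≤ 2 * ε₁ := by
    have h1 : q.comp (ContinuousLinearMap.inr ℝ ℝ X) - -p.comp (ContinuousLinearMap.inr ℝ ℝ X) =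
        (D + fderiv ℝ g Z).comp (ContinuousLinearMap.inr ℝ ℝ X) := by
      ext k
      have := congrArg (fun A : ℝ × X →L[ℝ] ℝ => A (0, k)) hpqD
      simp at this
      simp
      linarith
    have h2 := abs_norm_sub_norm_le (q.comp (ContinuousLinearMap.inr ℝ ℝ X))
      (-p.comp (ContinuousLinearMap.inr ℝ ℝ X))
    rw [norm_neg, h1] at h2
    refine h2.trans ((hcomp _).trans ((norm_add_le _ _).trans ?_))
    linarith
  have hr0 : 0 ≤ r := norm_nonneg _
  have hr'0 : 0 ≤ r' := norm_nonneg _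
  have hε₁L : max |r'| |r| ≤ L + 2 * ε₁ := by
    rw [abs_of_nonneg hr0, abs_of_nonneg hr'0]
    have h1 := abs_le.1 hrr
    rcases hpL with h | h
    · have h2 : r ≤ L := (hcomp p).trans h
      exact max_le (by linarith) (by linarith)
    · have h2 : r' ≤ L := (hcomp q).trans h
      exact max_le (by linarith) (by linarith)
  have hsub := hu Q.1 (hRS Q (hball Q hQ)).1 Q.2 _ hp.mem_psuperdiff
  have hsup := hv Q'.1 (hRS Q' (hball Q' hQ')).1 Q'.2 _
    (neg_mem_psubdiff (IsSupergradient.mem_psuperdiff (u := fun t x => -v t x) hq))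
  simp only [Prod.fst_neg, Prod.snd_neg, norm_neg] at hsub hsup
  have hH := (le_abs_self _).trans (hHA Q'.1 Q.1 (hRS Q' (hball Q' hQ')).1.le
    (hRS Q (hball Q hQ)).1.le Q'.2 Q.2 r' r)
  have hQQ : ‖Q' - Q‖ < 2 * ε := by
    have := norm_sub_le_norm_sub_add_norm_sub Q' P Q
    rw [norm_sub_rev P Q] at this
    linarith
  have hQ1 : |Q'.1 - Q.1| < 2 * ε := (norm_fst_le (Q' - Q)).trans_lt hQQ
  have hQ2 : ‖Q'.2 - Q.2‖ < 2 * ε := (norm_snd_le (Q' - Q)).trans_lt hQQ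
  have hω1 := hκω |Q'.1 - Q.1| ‖Q'.2 - Q.2‖ (r' - r) (abs_nonneg _) (by linarith)
    (by rw [abs_of_nonneg (norm_nonneg _)]; linarith) (by linarith)
  have hC1 : C * max |r'| |r| * (|Q'.1 - Q.1| + ‖Q'.2 - Q.2‖) ≤ C * (L + 2) * (4 * ε) := by
    refine mul_le_mul (mul_le_mul_of_nonneg_left ?_ hC) ?_ (by positivity) (by positivity)
    · linarith
    · linarith
  linarith

theorem stmt18 [CompleteSpace X] (hbump : HasC1LipBump X)
    (H₁ H₂ : ℝ → X → ℝ → ℝ)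
    (hH₁cont : ContinuousOn (fun p : ℝ × X × ℝ => H₁ p.1 p.2.1 p.2.2)
      {p : ℝ × X × ℝ | 0 ≤ p.1})
    (hH₂cont : ContinuousOn (fun p : ℝ × X × ℝ => H₂ p.1 p.2.1 p.2.2)
      {p : ℝ × X × ℝ | 0 ≤ p.1})
    (hH₁A : CondAEvol H₁) (hH₂A : CondAEvol H₂)
    (hHle : ∀ t : ℝ, 0 ≤ t → ∀ (x : X) (r : ℝ), H₁ t x r ≤ H₂ t x r)
    (h₁ h₂ : X → ℝ)
    (hh₁cont : Continuous h₁) (hh₂cont : Continuous h₂)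
    (hh₁bdd : ∃ C : ℝ, ∀ x, |h₁ x| ≤ C) (hh₂bdd : ∃ C : ℝ, ∀ x, |h₂ x| ≤ C)
    (hhle : ∀ x : X, h₂ x ≤ h₁ x)
    (u v : ℝ → X → ℝ)
    (hv : IsEvolSuper H₁ h₁ v) (hu : IsEvolSub H₂ h₂ u)
    (hbdd : ∀ T > (0:ℝ), ∃ C : ℝ, ∀ t : ℝ, 0 ≤ t → t < T → ∀ x : X,
      |u t x| ≤ C ∧ |v t x| ≤ C)
    (hLip : ∀ t : ℝ, 0 < t → ∀ x : X,
      (∃ δ > (0:ℝ), ∃ K : ℝ, ∀ (s s' : ℝ) (y y' : X), 0 ≤ s → 0 ≤ s' →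
        |s - t| + ‖y - x‖ < δ → |s' - t| + ‖y' - x‖ < δ →
        |u s y - u s' y'| ≤ K * (|s - s'| + ‖y - y'‖)) ∨
      (∃ δ > (0:ℝ), ∃ K : ℝ, ∀ (s s' : ℝ) (y y' : X), 0 ≤ s → 0 ≤ s' →
        |s - t| + ‖y - x‖ < δ → |s' - t| + ‖y' - x‖ < δ →
        |v s y - v s' y'| ≤ K * (|s - s'| + ‖y - y'‖))) :
    ∀ t : ℝ, 0 ≤ t → ∀ x : X, ((u t x - v t x : ℝ) : EReal) ≤
      (⨆ (t' : ℝ) (_ : 0 ≤ t') (x' : X) (r : ℝ),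
        ((H₂ t' x' r - H₁ t' x' r : ℝ) : EReal)) +
      (⨆ x' : X, ((h₂ x' - h₁ x' : ℝ) : EReal)) := by
  obtain ⟨θ, hθ⟩ := hbump.exists_isGauge_s18
  intro t ht x
  set A : EReal := ⨆ (t' : ℝ) (_ : 0 ≤ t') (x' : X) (r : ℝ),
    ((H₂ t' x' r - H₁ t' x' r : ℝ) : EReal) with hA
  set B : EReal := ⨆ x' : X, ((h₂ x' - h₁ x' : ℝ) : EReal) with hB
  have hA0 : 0 ≤ A := by
    refine le_trans ?_ (le_iSup_of_le 0 (le_iSup_of_le le_rfl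
      (le_iSup_of_le (0 : X) (le_iSup_of_le (0 : ℝ) le_rfl))))
    exact_mod_cast sub_nonneg.2 (hHle 0 le_rfl 0 0)
  have hBle : ∀ x' : X, ((h₂ x' - h₁ x' : ℝ) : EReal) ≤ B := fun x' =>
    le_iSup (fun x' : X => ((h₂ x' - h₁ x' : ℝ) : EReal)) x'
  have hB0 : B ≤ 0 := iSup_le fun x' => by exact_mod_cast sub_nonpos.2 (hhle x')
  obtain ⟨M, hM⟩ : ∃ M : ℝ, (M : EReal) = B :=
    ⟨B.toReal, EReal.coe_toReal (hB0.trans_lt EReal.zero_lt_top).ne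
      ((EReal.bot_lt_coe _).trans_le (hBle 0)).ne'⟩
  have hinit : ∀ x', u 0 x' - v 0 x' ≤ M := by
    intro x'
    have h1 := hBle x'
    rw [← hM, EReal.coe_le_coe_iff] at h1
    linarith [hu.2.2 x', hv.2.2 x']
  have hmain := evolution_comparison hθ hH₁A hu.1 hv.1
    (fun t ht x p hp => (add_le_add_right (hHle t ht.le x _) _).trans (hu.2.1 t ht x p hp))
    hv.2.1 hbdd hLip hinit ht x
  calc ((u t x - v t x : ℝ) : EReal) ≤ (M : EReal) := EReal.coe_le_coe_iff.2 hmain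
    _ = 0 + B := by rw [zero_add, hM]
    _ ≤ A + B := add_le_add_left hA0 B
end
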